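/- arXiv:1610.00176 — 2 statements merged into one kernel-verified Lean document; each statement's English description precedes it below -/
import Mathlib

section
/- The following are equivalent: (i) I_X is a complete intersection, i.e. there exist homogeneous polynomials f, g ∈ R with I_X = ⟨f, g⟩; (ii) I_X^m = I_X^{(m)} for every m ≥ 1; (iii) I_X^m = I_X^{(m)} for some m ≥ 2. -/
open MvPolynomial

/-- The homogeneous ideal of the point of `ℙ²` represented by `v ∈ k³`:
the ideal generated by all linear forms vanishing at `v`. -/
noncomputable def pointIdeal {k : Type*} [Field k] (v : Fin 3 → k) :
    Ideal (MvPolynomial (Fin 3) k) :=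
  Ideal.span {f | f.IsHomogeneous 1 ∧ MvPolynomial.eval v f = 0}

/-- The ideal `I_X = ⋂ᵢ I_{vᵢ}` of the set of points represented by `v`. -/
noncomputable def pointsIdeal {k : Type*} [Field k] {s : ℕ} (v : Fin s → (Fin 3 → k)) :
    Ideal (MvPolynomial (Fin 3) k) :=
  ⨅ i, pointIdeal (v i)

/-- The `m`-th symbolic power `I_X^{(m)} = ⋂ᵢ I_{vᵢ}^m`. -/
noncomputable def pointsSymb {k : Type*} [Field k] {s : ℕ} (v : Fin s → (Fin 3 → k)) (m : ℕ) :
    Ideal (MvPolynomial (Fin 3) k) :=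
  ⨅ i, (pointIdeal (v i)) ^ m

/-- The degree-`t` graded component of an ideal of `k[x₀,x₁,x₂]`, as a `k`-subspace. -/
noncomputable def gradedPiece {k : Type*} [Field k]
    (I : Ideal (MvPolynomial (Fin 3) k)) (t : ℕ) :
    Submodule k (MvPolynomial (Fin 3) k) :=
  Submodule.restrictScalars k I ⊓ MvPolynomial.homogeneousSubmodule (Fin 3) k t

section KoszulRelations

variable {S ι : Type*} [CommRing S]

/-- Every linear relation among the `L i`, `i ∈ J`, is a combination of the trivial ones. -/
def KoszulExactOn (L : ι → S) (J : Finset ι) : Prop :=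
  ∀ Q : ι → S, ∑ i ∈ J, Q i * L i = 0 →
    ∃ H : ι → ι → S, ∀ i ∈ J, Q i = ∑ j ∈ J, (H i j - H j i) * L j

theorem koszulExactOn_empty (L : ι → S) : KoszulExactOn L ∅ :=
  fun _ _ => ⟨0, by simp⟩

theorem KoszulExactOn.insert [DecidableEq ι] {L : ι → S} {J : Finset ι} (h : KoszulExactOn L J)
    {a : ι} (ha : a ∉ J)
    (hreg : ∀ u, u * L a ∈ Ideal.span (L '' J) → u ∈ Ideal.span (L '' J)) :
    KoszulExactOn L (insert a J) := by
  intro Q hQ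
  rw [Finset.sum_insert ha] at hQ
  have hmem : ∀ u : S, u ∈ Ideal.span (L '' J) ↔ ∃ c : ι → S, ∑ i ∈ J, c i * L i = u := by
    intro u
    refine ⟨fun hu => ?_, ?_⟩
    · obtain ⟨c, hc⟩ := (Submodule.mem_span_image_finset_iff_exists_fun S).1 hu
      refine ⟨fun i => if h : i ∈ J then c ⟨i, h⟩ else 0, ?_⟩
      rw [← hc, ← Finset.sum_coe_sort J]
      exact Finset.sum_congr rfl fun i _ => by simp
    · rintro ⟨c, rfl⟩
      exact Ideal.sum_mem _ fun i hi =>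
        Ideal.mul_mem_left _ _ (Ideal.subset_span ⟨i, hi, rfl⟩)
  obtain ⟨c, hc⟩ := (hmem _).1 (hreg (Q a) ((hmem _).2 ⟨fun i => -Q i, by
    simp only [neg_mul, Finset.sum_neg_distrib]; linear_combination -hQ⟩))
  obtain ⟨H, hH⟩ := h (fun i => Q i + c i * L a) (by
    simp only [add_mul, Finset.sum_add_distrib]
    rw [← hQ, ← hc, Finset.sum_mul, add_comm]
    congr 1
    exact Finset.sum_congr rfl fun i _ => by ring)
  refine ⟨fun i j => if i = a then (if j = a then 0 else c j) else if j = a then 0 else H i j,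
    fun i hi => ?_⟩
  rw [Finset.sum_insert ha]
  have hne : ∀ j ∈ J, j ≠ a := fun j hj e => ha (e ▸ hj)
  rcases Finset.mem_insert.1 hi with rfl | hi
  · rw [← hc]
    simp only [if_true, sub_self, zero_mul, zero_add]
    exact Finset.sum_congr rfl fun j hj => by simp [hne j hj]
  · have := hH i hi
    simp only [if_true, if_neg (hne i hi)]
    rw [eq_sub_of_add_eq this, sub_eq_add_neg, add_comm]
    congr 1
    · ring
    · exact Finset.sum_congr rfl fun j hj => by simp [hne j hj]

theorem KoszulExactOn.of_factor {κ : Type*} [Fintype κ] {Λ : ι → S} {J : Finset ι} {L : κ → S}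
    (h : KoszulExactOn Λ J) [DecidableEq κ] (α : κ → ι → S) (β : ι → κ → S)
    (hα : ∀ j, L j = ∑ i ∈ J, α j i * Λ i) (hβ : ∀ i ∈ J, Λ i = ∑ j, β i j * L j)
    (hαβ : ∀ j j', ∑ i ∈ J, α j i * β i j' = if j = j' then 1 else 0) :
    KoszulExactOn L Finset.univ := by
  intro Q hQ
  obtain ⟨H, hH⟩ := h (fun i => ∑ j, Q j * α j i) (by
    rw [← hQ]
    simp_rw [hα, Finset.mul_sum, Finset.sum_mul]
    rw [Finset.sum_comm]
    exact Finset.sum_congr rfl fun _ _ => Finset.sum_congr rfl fun _ _ => by ring)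
  refine ⟨fun j j' => ∑ i ∈ J, ∑ i' ∈ J, β i j * H i i' * β i' j', fun j _ => ?_⟩
  calc Q j = ∑ j', Q j' * (if j' = j then 1 else 0) := by simp
    _ = ∑ i ∈ J, (∑ j', Q j' * α j' i) * β i j := by
      simp_rw [← hαβ, Finset.mul_sum, Finset.sum_mul]
      rw [Finset.sum_comm]
      exact Finset.sum_congr rfl fun _ _ => Finset.sum_congr rfl fun _ _ => by ring
    _ = ∑ i ∈ J, (∑ i' ∈ J, (H i i' - H i' i) * ∑ j', β i' j' * L j') * β i j := by
      refine Finset.sum_congr rfl fun i hi => ?_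
      rw [hH i hi]
      congr 1
      exact Finset.sum_congr rfl fun i' hi' => by rw [← hβ i' hi']
    _ = ∑ i ∈ J, ∑ i' ∈ J, ∑ j', β i j * (H i i' - H i' i) * β i' j' * L j' := by
      refine Finset.sum_congr rfl fun i hi => ?_
      rw [Finset.sum_mul]
      refine Finset.sum_congr rfl fun i' hi' => ?_
      rw [Finset.mul_sum, Finset.sum_mul]
      exact Finset.sum_congr rfl fun _ _ => by ring
    _ = ∑ j', ∑ i ∈ J, ∑ i' ∈ J, β i j * (H i i' - H i' i) * β i' j' * L j' := by
      conv_rhs => rw [Finset.sum_comm]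
      refine Finset.sum_congr rfl fun i _ => ?_
      conv_rhs => rw [Finset.sum_comm]
    _ = _ := by
      refine Finset.sum_congr rfl fun j' _ => ?_
      have hswap : ∑ i ∈ J, ∑ i' ∈ J, β i j' * H i i' * β i' j =
          ∑ i ∈ J, ∑ i' ∈ J, β i' j' * H i' i * β i j := Finset.sum_comm
      beta_reduce
      rw [hswap]
      simp only [Finset.sum_mul, sub_mul, ← Finset.sum_sub_distrib]
      exact Finset.sum_congr rfl fun i _ => Finset.sum_congr rfl fun i' _ => by ring

end KoszulRelations

section Rees

variable {A σ : Type*} [CommRing A]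

/-- The map onto the Rees algebra sending the variable `i` to `f i` in degree one. -/
noncomputable def reesHom (f : σ → A) : MvPolynomial σ A →ₐ[A] Polynomial A :=
  aeval fun i => Polynomial.C (f i) * Polynomial.X

/-- The linear form with coefficient vector `w`. -/
noncomputable def linForm [Fintype σ] (w : σ → A) : MvPolynomial σ A :=
  ∑ i, C (w i) * X i

@[simp] theorem reesHom_X (f : σ → A) (i : σ) :
    reesHom f (X i) = Polynomial.C (f i) * Polynomial.X := by
  simp [reesHom]

@[simp] theorem reesHom_C (f : σ → A) (a : A) : reesHom f (C a) = Polynomial.C a := by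
  simp [reesHom]

theorem reesHom_linForm [Fintype σ] (f w : σ → A) :
    reesHom f (linForm w) = Polynomial.C (∑ i, w i * f i) * Polynomial.X := by
  simp [linForm, Finset.sum_mul, mul_assoc]

theorem C_dvd_of_C_dvd_C_mul_X_mul {f g : A} (hK : ∀ u, f ∣ u * g → f ∣ u) (i : σ)
    {H : MvPolynomial σ A} (h : C f ∣ C g * X i * H) : C f ∣ H := by
  rw [C_dvd_iff_dvd_coeff] at h ⊢
  intro m
  refine hK _ ?_
  have := h (Finsupp.single i 1 + m)
  rwa [mul_assoc, coeff_C_mul, coeff_X_mul, mul_comm] at this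

variable [IsDomain A]

theorem dvd_of_reesHom_pair_eq_zero {f g : A} (hf : f ≠ 0) (hK : ∀ u, f ∣ u * g → f ∣ u)
    {P : MvPolynomial (Fin 2) A} (hP : reesHom ![f, g] P = 0) :
    C g * X 0 - C f * X 1 ∣ P := by
  have key : ∀ P : MvPolynomial (Fin 2) A, ∃ (N : ℕ) (H : MvPolynomial (Fin 2) A)
      (Q : Polynomial A), C f ^ N * P = (C g * X 0 - C f * X 1) * H + Polynomial.aeval (X 0) Q := by
    intro P
    induction P using MvPolynomial.induction_on with
    | C a => exact ⟨0, 0, Polynomial.C a, by simp [MvPolynomial.algebraMap_eq]⟩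
    | add P P' h h' =>
      obtain ⟨N, H, Q, e⟩ := h
      obtain ⟨N', H', Q', e'⟩ := h'
      refine ⟨N + N', C f ^ N' * H + C f ^ N * H',
        Polynomial.C (f ^ N') * Q + Polynomial.C (f ^ N) * Q', ?_⟩
      simp only [map_add, map_mul, Polynomial.aeval_C, MvPolynomial.algebraMap_eq, map_pow]
      linear_combination C f ^ N' * e + C f ^ N * e'
    | mul_X P i h =>
      obtain ⟨N, H, Q, e⟩ := h
      fin_cases i
      · refine ⟨N, H * X 0, Q * Polynomial.X, ?_⟩
        simp only [map_mul, Polynomial.aeval_X, Fin.zero_eta]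
        linear_combination X 0 * e
      · refine ⟨N + 1, C f * X 1 * H - Polynomial.aeval (X 0) Q,
          Polynomial.C g * Q * Polynomial.X, ?_⟩
        simp only [map_mul, Polynomial.aeval_X, Polynomial.aeval_C, MvPolynomial.algebraMap_eq,
          Fin.mk_one]
        linear_combination C f * X 1 * e
  obtain ⟨N, H, Q, e⟩ := key P
  have hQ : Q = 0 := by
    have h := congrArg (reesHom ![f, g]) e
    simp only [map_mul, map_add, map_sub, hP, reesHom_C, reesHom_X, map_pow, mul_zero,
      Matrix.cons_val_zero, Matrix.cons_val_one, ← Polynomial.aeval_algHom_apply] at h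
    have h0 : Polynomial.C g * (Polynomial.C f * Polynomial.X) -
        Polynomial.C f * (Polynomial.C g * Polynomial.X) = (0 : Polynomial A) := by ring
    rw [h0, zero_mul, zero_add] at h
    exact (Polynomial.comp_C_mul_X_eq_zero_iff (mem_nonZeroDivisors_of_ne_zero hf)).1 h.symm
  subst hQ
  rw [map_zero, add_zero] at e
  clear hP key
  induction N generalizing P H with
  | zero => exact ⟨H, by simpa using e⟩
  | succ N ih =>
    have hdvd : C f ∣ H := by
      refine C_dvd_of_C_dvd_C_mul_X_mul hK (0 : Fin 2) ⟨C f ^ N * P + X 1 * H, ?_⟩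
      linear_combination -e
    obtain ⟨H', rfl⟩ := hdvd
    refine ih H' (mul_left_cancel₀ ((C_ne_zero (σ := Fin 2)).2 hf) ?_)
    linear_combination e

end Rees

section TwoGenerated

variable {A ι : Type*} [CommRing A] [Fintype ι] [DecidableEq ι]

@[simp] theorem linForm_single (i : ι) (c : A) : linForm (Pi.single i c) = C c * X i := by
  rw [linForm, Finset.sum_eq_single i]
  · simp
  · intro j _ hj
    simp [hj]
  · simp

omit [DecidableEq ι] in
theorem linForm_sum {κ : Type*} (J : Finset κ) (c : κ → A) (M : κ → ι → A) :
    linForm (fun i => ∑ j ∈ J, c j * M j i) = ∑ j ∈ J, C (c j) * linForm (M j) := by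
  simp only [linForm, map_sum, Finset.sum_mul, Finset.mul_sum, map_mul, mul_assoc]
  exact Finset.sum_comm

omit [DecidableEq ι] in
theorem linForm_sub (v w : ι → A) : linForm (v - w) = linForm v - linForm w := by
  simp [linForm, sub_mul]

/-- The standard relations when all `f i` are expressed through `f a` and `f b`. -/
def pairRelation (f γ δ : ι → A) (a b i : ι) : ι → A :=
  if i = b then Pi.single a (f b) - Pi.single b (f a)
  else Pi.single i 1 - Pi.single a (γ i) - Pi.single b (δ i)

variable {f γ δ : ι → A} {a b : ι}

theorem linForm_pairRelation_self :
    linForm (pairRelation f γ δ a b b) = C (f b) * X a - C (f a) * X b := by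
  simp [pairRelation, linForm_sub]

theorem linForm_pairRelation_of_ne {i : ι} (hi : i ≠ b) :
    linForm (pairRelation f γ δ a b i) = X i - C (γ i) * X a - C (δ i) * X b := by
  simp [pairRelation, hi, linForm_sub]

theorem exists_eq_sum_pairRelation [IsDomain A] (hab : a ≠ b) (hfa : f a ≠ 0)
    (hf : ∀ i, f i = γ i * f a + δ i * f b) (hK : ∀ u, f a ∣ u * f b → f a ∣ u)
    {w : ι → A} (hw : ∑ i, w i * f i = 0) :
    ∃ c : ι → A, w = fun i => ∑ j ∈ Finset.univ.erase a, c j * pairRelation f γ δ a b j i := by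
  set J := (Finset.univ.erase a).erase b with hJ
  have hbJ : b ∉ J := by simp [hJ]
  have hins : Finset.univ.erase a = insert b J := by
    rw [hJ, Finset.insert_erase]
    simp [hab.symm]
  have huniv : (Finset.univ : Finset ι) = insert a (insert b J) := by
    rw [← hins, Finset.insert_erase (Finset.mem_univ a)]
  have haJ : a ∉ insert b J := by simp [← hins]
  have hJne : ∀ j ∈ J, j ≠ a ∧ j ≠ b := fun j hj => by
    simp only [hJ, Finset.mem_erase] at hj
    exact ⟨hj.2.1, hj.1⟩
  have hsum : (w a + ∑ i ∈ J, w i * γ i) * f a + (w b + ∑ i ∈ J, w i * δ i) * f b = 0 := by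
    rw [huniv, Finset.sum_insert haJ, Finset.sum_insert hbJ] at hw
    have : ∑ i ∈ J, w i * f i = (∑ i ∈ J, w i * γ i) * f a + (∑ i ∈ J, w i * δ i) * f b := by
      rw [Finset.sum_mul, Finset.sum_mul, ← Finset.sum_add_distrib]
      exact Finset.sum_congr rfl fun i _ => by rw [hf i]; ring
    rw [this] at hw
    linear_combination hw
  obtain ⟨e, he⟩ := hK (w b + ∑ i ∈ J, w i * δ i) ⟨-(w a + ∑ i ∈ J, w i * γ i),
      by linear_combination hsum⟩
  have he' : w a + ∑ i ∈ J, w i * γ i = - e * f b := by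
    apply mul_right_cancel₀ hfa
    linear_combination hsum - f b * he
  refine ⟨fun j => if j = b then -e else w j, ?_⟩
  ext i
  rw [hins, Finset.sum_insert hbJ, Finset.sum_congr rfl (g := fun j =>
    w j * (Pi.single j 1 - Pi.single a (γ j) - Pi.single b (δ j) : ι → A) i)
    (fun j hj => by simp [pairRelation, (hJne j hj).2])]
  simp only [if_true, pairRelation, Pi.sub_apply, Pi.single_apply, mul_sub,
    Finset.sum_sub_distrib]
  by_cases hia : i = a
  · subst hia
    rw [Finset.sum_eq_zero fun j hj => by simp [(hJne j hj).1.symm]]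
    simp only [if_true, hab, if_false, mul_zero, Finset.sum_const_zero]
    linear_combination he'
  · by_cases hib : i = b
    · subst hib
      rw [Finset.sum_eq_zero fun j hj => by simp [(hJne j hj).2.symm]]
      simp only [if_true, hia, if_false, mul_zero, Finset.sum_const_zero]
      linear_combination he
    · have hiJ : i ∈ J := by simp [hJ, hia, hib]
      simp [hia, hib, hiJ]

/-- Substitution eliminating the variables in `J` by means of the standard relations. -/
noncomputable def pairSubst (γ δ : ι → A) (a b : ι) (J : Finset ι) :
    MvPolynomial ι A →ₐ[A] MvPolynomial ι A :=
  aeval fun i => if i ∈ J then C (γ i) * X a + C (δ i) * X b else X i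

theorem sub_pairSubst_mem {J : Finset ι} (hb : b ∉ J) (P : MvPolynomial ι A) :
    P - pairSubst γ δ a b J P ∈
      Ideal.span ((fun i => linForm (pairRelation f γ δ a b i)) '' J) := by
  set I := Ideal.span ((fun i => linForm (pairRelation f γ δ a b i)) '' (J : Set ι)) with hI
  rw [← Ideal.Quotient.mk_eq_mk_iff_sub_mem]
  have : (Ideal.Quotient.mkₐ A I) = (Ideal.Quotient.mkₐ A I).comp (pairSubst γ δ a b J) := by
    ext i
    simp only [Ideal.Quotient.mkₐ_eq_mk, AlgHom.coe_comp, Function.comp_apply, pairSubst, aeval_X]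
    split_ifs with h
    · rw [Ideal.Quotient.mk_eq_mk_iff_sub_mem]
      refine Ideal.subset_span ⟨i, h, ?_⟩
      simp only [linForm_pairRelation_of_ne (fun e : i = b => hb (e ▸ h))]
      ring
    · rfl
  exact DFunLike.congr_fun this P

theorem pairSubst_eq_zero_of_mem {J : Finset ι} (ha : a ∉ J) (hb : b ∉ J)
    {P : MvPolynomial ι A}
    (hP : P ∈ Ideal.span ((fun i => linForm (pairRelation f γ δ a b i)) '' J)) :
    pairSubst γ δ a b J P = 0 := by
  have : Ideal.span ((fun i => linForm (pairRelation f γ δ a b i)) '' (J : Set ι)) ≤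
      RingHom.ker (pairSubst γ δ a b J) := by
    rw [Ideal.span_le]
    rintro _ ⟨i, hi, rfl⟩
    have hib : i ≠ b := fun e => hb (e ▸ hi)
    rw [SetLike.mem_coe, RingHom.mem_ker]
    simp only [linForm_pairRelation_of_ne hib]
    simp only [pairSubst, map_sub, map_mul, aeval_X, if_neg ha, if_neg hb,
      if_pos (Finset.mem_coe.1 hi), algHom_C, MvPolynomial.algebraMap_eq]
    ring
  exact this hP

variable [IsDomain A]

theorem koszulExactOn_pairRelation (hab : a ≠ b) (hfa : f a ≠ 0) :
    KoszulExactOn (fun i => linForm (pairRelation f γ δ a b i)) (Finset.univ.erase a) := by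
  have hstep : ∀ (J : Finset ι) (i : ι), a ∉ J → b ∉ J → i ∉ J → i ≠ a →
      KoszulExactOn (fun i => linForm (pairRelation f γ δ a b i)) J →
      KoszulExactOn (fun i => linForm (pairRelation f γ δ a b i)) (insert i J) := by
    intro J i ha hb hi hia h
    refine h.insert hi fun u hu => ?_
    have h0 := pairSubst_eq_zero_of_mem ha hb hu
    have hfix : pairSubst γ δ a b J (linForm (pairRelation f γ δ a b i)) =
        linForm (pairRelation f γ δ a b i) := by
      by_cases hib : i = b
      · subst hib
        rw [linForm_pairRelation_self]
        simp [pairSubst, ha, hb, MvPolynomial.algebraMap_eq]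
      · rw [linForm_pairRelation_of_ne hib]
        simp [pairSubst, ha, hb, hi, MvPolynomial.algebraMap_eq]
    have hne : linForm (pairRelation f γ δ a b i) ≠ 0 := by
      by_cases hib : i = b
      · subst hib
        rw [linForm_pairRelation_self]
        intro e
        have := congrArg (coeff (Finsupp.single i 1)) e
        simp only [coeff_sub, coeff_C_mul, coeff_zero, coeff_X, Finsupp.single_left_inj one_ne_zero,
          hab, if_true, if_false] at this
        simp [hfa] at this
      · rw [linForm_pairRelation_of_ne hib]
        intro e
        have := congrArg (coeff (Finsupp.single i 1)) e
        simp only [coeff_sub, coeff_C_mul, coeff_zero, coeff_X, Finsupp.single_left_inj one_ne_zero,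
          Ne.symm hia, Ne.symm hib, if_true, if_false] at this
        simp at this
    rw [map_mul, hfix] at h0
    have hu0 := (mul_eq_zero.1 h0).resolve_right hne
    simpa [hu0] using sub_pairSubst_mem (f := f) (γ := γ) (δ := δ) (a := a) hb u
  have hall : ∀ J : Finset ι, a ∉ J → b ∉ J →
      KoszulExactOn (fun i => linForm (pairRelation f γ δ a b i)) J := by
    intro J
    induction J using Finset.induction_on with
    | empty => exact fun _ _ => koszulExactOn_empty _
    | insert i J hi ih =>
      intro ha hb
      rw [Finset.mem_insert, not_or] at ha hb
      exact hstep J i ha.2 hb.2 hi (Ne.symm ha.1) (ih ha.2 hb.2)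
  have := hstep ((Finset.univ.erase a).erase b) b (by simp) (by simp) (by simp) hab.symm
    (hall _ (by simp) (by simp))
  rwa [Finset.insert_erase (by simp [hab.symm])] at this

theorem mem_span_pairRelation_of_reesHom_eq_zero (hab : a ≠ b) (hfa : f a ≠ 0)
    (hf : ∀ i, f i = γ i * f a + δ i * f b) (hK : ∀ u, f a ∣ u * f b → f a ∣ u)
    (hγa : γ a = 1) (hδa : δ a = 0) (hγb : γ b = 0) (hδb : δ b = 1)
    {P : MvPolynomial ι A} (hP : reesHom f P = 0) :
    P ∈ Ideal.span ((fun i => linForm (pairRelation f γ δ a b i)) '' (Finset.univ.erase a)) := by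
  set J := (Finset.univ.erase a).erase b with hJ
  have hbJ : b ∉ J := by simp [hJ]
  have hins : Finset.univ.erase a = insert b J := by
    rw [hJ, Finset.insert_erase]
    simp [hab.symm]
  let r : MvPolynomial ι A →ₐ[A] MvPolynomial (Fin 2) A :=
    aeval fun i => C (γ i) * X 0 + C (δ i) * X 1
  let j : MvPolynomial (Fin 2) A →ₐ[A] MvPolynomial ι A := aeval ![X a, X b]
  have hrees : (reesHom ![f a, f b]).comp r = reesHom f := by
    ext i : 1
    simp only [r, AlgHom.coe_comp, Function.comp_apply, aeval_X, map_add, map_mul, reesHom_C,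
      reesHom_X]
    simp only [Matrix.cons_val_zero, Matrix.cons_val_one]
    rw [hf i]
    simp only [map_add, map_mul]
    ring
  have hjr : j.comp r = pairSubst γ δ a b J := by
    ext i : 1
    simp only [r, j, pairSubst, AlgHom.coe_comp, Function.comp_apply, aeval_X, map_add, map_mul,
      algHom_C, MvPolynomial.algebraMap_eq]
    simp only [Matrix.cons_val_zero, Matrix.cons_val_one]
    split_ifs with h
    · rfl
    · simp only [hJ, Finset.mem_erase, Finset.mem_univ, and_true, not_and, not_not] at h
      by_cases hib : i = b
      · subst hib; simp [hγb, hδb]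
      · rw [h hib]; simp [hγa, hδa]
  have hdvd : C (f b) * X 0 - C (f a) * X 1 ∣ r P :=
    dvd_of_reesHom_pair_eq_zero hfa hK (by
      rw [← hP, ← hrees]; rfl)
  obtain ⟨H, hH⟩ := hdvd
  have h2 : pairSubst γ δ a b J P = linForm (pairRelation f γ δ a b b) * j H := by
    rw [← hjr, AlgHom.comp_apply, hH, map_mul, linForm_pairRelation_self]
    simp [j, MvPolynomial.algebraMap_eq]
  rw [hins, ← sub_add_cancel P (pairSubst γ δ a b J P)]
  refine add_mem (Ideal.span_mono (Set.image_mono ?_) (sub_pairSubst_mem hbJ P)) ?_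
  · exact_mod_cast Finset.subset_insert b J
  · rw [h2]
    exact Ideal.mul_mem_right _ _ (Ideal.subset_span ⟨b, by simp, rfl⟩)

end TwoGenerated

section LocallyTwoGenerated

theorem sum_pairRelation_mul {A ι : Type*} [CommRing A] [Fintype ι] [DecidableEq ι]
    {f γ δ : ι → A} {a b : ι} (hf : ∀ i, f i = γ i * f a + δ i * f b) (i : ι) :
    ∑ j, pairRelation f γ δ a b i j * f j = 0 := by
  unfold pairRelation
  split_ifs with h
  · simp only [Pi.sub_apply, sub_mul, Finset.sum_sub_distrib, Pi.single_apply, ite_mul, zero_mul,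
      Finset.sum_ite_eq', Finset.mem_univ, if_true]
    ring
  · simp only [Pi.sub_apply, sub_mul, Finset.sum_sub_distrib, Pi.single_apply, ite_mul, zero_mul,
      Finset.sum_ite_eq', Finset.mem_univ, if_true, one_mul]
    linear_combination hf i

variable {A ι κ : Type*} [CommRing A] [IsDomain A] [Fintype ι] [DecidableEq ι] [Fintype κ]
  [DecidableEq κ] {f γ δ : ι → A} {a b : ι} {M : κ → ι → A}

theorem exact_of_pair (hab : a ≠ b) (hfa : f a ≠ 0)
    (hf : ∀ i, f i = γ i * f a + δ i * f b) (hK : ∀ u, f a ∣ u * f b → f a ∣ u)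
    (hγa : γ a = 1) (hδa : δ a = 0) (hγb : γ b = 0) (hδb : δ b = 1)
    (hM : ∀ j, ∑ i, M j i * f i = 0)
    (hspan : ∀ w : ι → A, ∑ i, w i * f i = 0 → ∃ c : κ → A, w = fun i => ∑ j, c j * M j i)
    (hind : ∀ c : κ → A, (∀ i, ∑ j, c j * M j i = 0) → c = 0) :
    (∀ P, reesHom f P = 0 → P ∈ Ideal.span (Set.range fun j => linForm (M j))) ∧
      KoszulExactOn (fun j => linForm (M j)) Finset.univ := by
  choose α hα using fun j => exists_eq_sum_pairRelation hab hfa hf hK (hM j)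
  choose β hβ using fun i => hspan _ (sum_pairRelation_mul (a := a) (b := b) hf i)
  have hβ' : ∀ i, linForm (pairRelation f γ δ a b i) = ∑ j, C (β i j) * linForm (M j) :=
    fun i => by rw [hβ i, linForm_sum]
  constructor
  · intro P hP
    refine (Ideal.span_le.2 ?_)
      (mem_span_pairRelation_of_reesHom_eq_zero hab hfa hf hK hγa hδa hγb hδb hP)
    rintro _ ⟨i, _, rfl⟩
    simp only [hβ' i]
    exact Ideal.sum_mem _ fun j _ => Ideal.mul_mem_left _ _ (Ideal.subset_span ⟨j, rfl⟩)
  · refine KoszulExactOn.of_factor (koszulExactOn_pairRelation (γ := γ) (δ := δ) hab hfa)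
      (fun j i => C (α j i)) (fun i j => C (β i j)) (fun j => ?_) (fun i _ => hβ' i) ?_
    · conv_lhs => rw [hα j]
      rw [linForm_sum]
    · intro j j'
      have := hind (fun j' => ∑ i ∈ Finset.univ.erase a,
          α j i * β i j' - if j = j' then 1 else 0) (by
        intro i
        simp only [sub_mul, Finset.sum_sub_distrib, Finset.sum_mul, ite_mul, one_mul, zero_mul,
          Finset.sum_ite_eq, Finset.mem_univ, if_true]
        rw [Finset.sum_comm, sub_eq_zero]
        conv_rhs => rw [hα j]
        refine Finset.sum_congr rfl fun l _ => ?_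
        rw [hβ l, Finset.mul_sum]
        exact Finset.sum_congr rfl fun _ _ => by ring)
      have := sub_eq_zero.1 (congrFun this j')
      rw [← map_one C, ← map_zero C, ← apply_ite C, ← this, map_sum]
      simp

end LocallyTwoGenerated

section Exchange

theorem exists_sup_span_singleton_eq {A ι : Type*} [CommRing A] [IsLocalRing A] [Finite ι]
    [Nonempty ι] {f : ι → A} {J : Ideal A} {q : A}
    (h : Ideal.span (Set.range f) = J ⊔ Ideal.span {q}) :
    ∃ a, Ideal.span (Set.range f) = J ⊔ Ideal.span {f a} := by
  classical
  cases nonempty_fintype ι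
  have hq : q ∈ Ideal.span (Set.range f) := h ▸
      Ideal.mem_sup_right (Ideal.mem_span_singleton_self q)
  obtain ⟨α, hα⟩ := (Ideal.mem_span_range_iff_exists_fun).1 hq
  have hfi : ∀ i, ∃ j ∈ J, ∃ β, f i = j + β * q := by
    intro i
    have : f i ∈ J ⊔ Ideal.span {q} := h ▸ Ideal.subset_span ⟨i, rfl⟩
    obtain ⟨j, hj, y, hy, e⟩ := Submodule.mem_sup.1 this
    obtain ⟨β, rfl⟩ := Ideal.mem_span_singleton'.1 hy
    exact ⟨j, hj, β, e.symm⟩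
  choose j hj β hβ using hfi
  have hle : ∀ a, J ⊔ Ideal.span {f a} ≤ Ideal.span (Set.range f) := fun a =>
    sup_le (h ▸ le_sup_left) ((Ideal.span_singleton_le_iff_mem _).2 (Ideal.subset_span ⟨a, rfl⟩))
  have hback : ∀ a, q ∈ J ⊔ Ideal.span {f a} →
      Ideal.span (Set.range f) = J ⊔ Ideal.span {f a} := fun a ha =>
    le_antisymm (h.le.trans (sup_le le_sup_left ((Ideal.span_singleton_le_iff_mem _).2 ha))) (hle a)
  by_cases hu : ∃ a, IsUnit (β a)
  · obtain ⟨a, u, hu⟩ := hu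
    refine ⟨a, hback a ?_⟩
    have : q = (↑u⁻¹ : A) * (f a - j a) := by
      rw [hβ a, ← hu, add_sub_cancel_left, Units.inv_mul_cancel_left]
    rw [this]
    exact Ideal.mul_mem_left _ _ (sub_mem (Ideal.mem_sup_right (Ideal.mem_span_singleton_self _))
      (Ideal.mem_sup_left (hj a)))
  · push Not at hu
    have hm : ∑ i, α i * β i ∈ IsLocalRing.maximalIdeal A :=
      Ideal.sum_mem _ fun i _ => Ideal.mul_mem_left _ _ ((IsLocalRing.mem_maximalIdeal _).2 (hu i))
    have hunit : IsUnit (1 - ∑ i, α i * β i) := by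
      by_contra hn
      have := add_mem ((IsLocalRing.mem_maximalIdeal _).2 hn) hm
      rw [sub_add_cancel] at this
      exact (IsLocalRing.mem_maximalIdeal _).1 this isUnit_one
    obtain ⟨u, hu⟩ := hunit
    have hqJ : q ∈ J := by
      have : q = (↑u⁻¹ : A) * ∑ i, α i * j i := by
        rw [Units.eq_inv_mul_iff_mul_eq, hu, sub_mul, one_mul, Finset.sum_mul]
        nth_rw 1 [← hα]
        simp_rw [hβ, mul_add, Finset.sum_add_distrib]
        simp [mul_assoc]
      rw [this]
      exact Ideal.mul_mem_left _ _ (Ideal.sum_mem _ fun i _ => Ideal.mul_mem_left _ _ (hj i))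
    exact ⟨Classical.arbitrary ι, hback _ (Ideal.mem_sup_left hqJ)⟩

theorem exists_pair_span_eq {A ι : Type*} [CommRing A] [IsLocalRing A] [Finite ι] [Nontrivial ι]
    {f : ι → A} {p q : A} (h : Ideal.span (Set.range f) = Ideal.span {p, q}) :
    ∃ a b, a ≠ b ∧ Ideal.span (Set.range f) = Ideal.span {f a, f b} := by
  rw [Ideal.span_insert] at h
  obtain ⟨a, ha⟩ := exists_sup_span_singleton_eq h
  rw [sup_comm] at ha
  obtain ⟨b, hb⟩ := exists_sup_span_singleton_eq ha
  by_cases hab : a = b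
  · subst hab
    obtain ⟨c, hc⟩ := exists_ne a
    refine ⟨a, c, hc.symm, le_antisymm ?_ ?_⟩
    · rw [hb, sup_idem]
      exact Ideal.span_mono (by simp)
    · rw [Ideal.span_le]
      rintro x (rfl | rfl)
      exacts [Ideal.subset_span ⟨_, rfl⟩, Ideal.subset_span ⟨_, rfl⟩]
  · exact ⟨a, b, hab, by rw [hb, ← Ideal.span_insert]⟩

end Exchange

section AtPrime

theorem map_linForm {B B' ι : Type*} [CommRing B] [CommRing B'] [Fintype ι] (φ : B →+* B')
    (w : ι → B) :
    MvPolynomial.map φ (linForm w) = linForm (fun i => φ (w i)) := by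
  simp [linForm]

theorem map_reesHom {B B' ι : Type*} [CommRing B] [CommRing B'] (φ : B →+* B') (f : ι → B)
    (P : MvPolynomial ι B) :
    reesHom (fun i => φ (f i)) (MvPolynomial.map φ P) = (reesHom f P).map φ := by
  induction P using MvPolynomial.induction_on with
  | C a => simp
  | add p q hp hq => simp [hp, hq]
  | mul_X p i hp => simp [hp]

theorem exists_common_denom {B σ τ : Type*} [CommRing B] [IsDomain B] [Finite τ] (P : Ideal B)
    [P.IsPrime]
    (H : τ → MvPolynomial σ (Localization.AtPrime P)) :
    ∃ s ∉ P, ∃ H₀ : τ → MvPolynomial σ B, ∀ i,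
      MvPolynomial.map (algebraMap B (Localization.AtPrime P)) (H₀ i) =
        C (algebraMap B _ s) * H i := by
  let _ : Algebra (MvPolynomial σ B) (MvPolynomial σ (Localization.AtPrime P)) :=
    MvPolynomial.algebraMvPolynomial
  obtain ⟨⟨_, s, hs, rfl⟩, hb⟩ := IsLocalization.exist_integer_multiples_of_finite
    (P.primeCompl.map (C : B →+* MvPolynomial σ B)) H
  choose H₀ hH₀ using hb
  refine ⟨s, hs, H₀, fun i => ?_⟩
  have := hH₀ i
  rw [Algebra.smul_def, MvPolynomial.algebraMap_def] at this
  rw [← MvPolynomial.map_C]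
  exact this

theorem exists_common_denom_ring {B τ : Type*} [CommRing B] [Finite τ] (P : Ideal B) [P.IsPrime]
    (w : τ → Localization.AtPrime P) :
    ∃ s ∉ P, ∃ w₀ : τ → B, ∀ i,
      algebraMap B (Localization.AtPrime P) (w₀ i) = algebraMap B _ s * w i := by
  obtain ⟨⟨s, hs⟩, hb⟩ := IsLocalization.exist_integer_multiples_of_finite P.primeCompl w
  choose w₀ hw₀ using hb
  refine ⟨s, hs, w₀, fun i => ?_⟩
  have := hw₀ i
  rw [Algebra.smul_def] at this
  simpa using this

variable {B ι κ : Type*} [CommRing B] [IsDomain B] [Fintype ι] [DecidableEq ι] [Fintype κ]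
  [DecidableEq κ] {f : ι → B} {M : κ → ι → B}

theorem exact_at_prime [Nontrivial ι] (hf0 : ∀ i, f i ≠ 0)
    (hM : ∀ j, ∑ i, M j i * f i = 0)
    (hspan : ∀ w : ι → B, ∑ i, w i * f i = 0 → ∃ c : κ → B, w = fun i => ∑ j, c j * M j i)
    (hind : ∀ c : κ → B, (∀ i, ∑ j, c j * M j i = 0) → c = 0)
    (hinv : ∀ a b : B, (∀ i, b ∣ a * f i) → b ∣ a) (P : Ideal B) [P.IsPrime]
    (hgood : ∃ p ∈ Ideal.span (Set.range f), ∃ q ∈ Ideal.span (Set.range f), ∃ s ∉ P,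
      ∀ i, s * f i ∈ Ideal.span {p, q}) :
    (∀ Q, reesHom f Q = 0 → ∃ s ∉ P, C s * Q ∈ Ideal.span (Set.range fun j => linForm (M j))) ∧
      (∀ Q : κ → MvPolynomial ι B, ∑ j, Q j * linForm (M j) = 0 →
        ∃ s ∉ P, ∃ H : κ → κ → MvPolynomial ι B, ∀ j,
          C s * Q j = ∑ j', (H j j' - H j' j) * linForm (M j')) := by
  set A := Localization.AtPrime P
  set φ := algebraMap B A
  have hφ : Function.Injective φ := IsLocalization.injective A P.primeCompl_le_nonZeroDivisors
  have : IsDomain A := IsLocalization.isDomain_localization P.primeCompl_le_nonZeroDivisors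
  have hunit : ∀ s ∉ P, IsUnit (φ s) := fun s hs => IsLocalization.map_units A
    (⟨s, hs⟩ : P.primeCompl)
  have hmapinj : Function.Injective (MvPolynomial.map φ : MvPolynomial ι B → MvPolynomial ι A) :=
    MvPolynomial.map_injective φ hφ
  let f' : ι → A := fun i => φ (f i)
  let M' : κ → ι → A := fun j i => φ (M j i)
  have hspanf : ∀ x ∈ Ideal.span (Set.range f), φ x ∈ Ideal.span (Set.range f') := by
    intro x hx
    have := Ideal.mem_map_of_mem φ hx
    rwa [Ideal.map_span, ← Set.range_comp] at this
  obtain ⟨p, hp, q, hq, s, hs, hsf⟩ := hgood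
  have hpair : Ideal.span (Set.range f') = Ideal.span {φ p, φ q} := by
    apply le_antisymm
    · rw [Ideal.span_le]
      rintro _ ⟨i, rfl⟩
      have h1 := Ideal.mem_map_of_mem φ (hsf i)
      rw [Ideal.map_span, Set.image_pair, map_mul] at h1
      exact (Ideal.unit_mul_mem_iff_mem _ (hunit s hs)).1 h1
    · rw [Ideal.span_le]
      rintro x (rfl | rfl)
      exacts [hspanf _ hp, hspanf _ hq]
  obtain ⟨a, b, hab, hspanab⟩ := exists_pair_span_eq hpair
  have hcoef : ∀ i, ∃ g d : A, f' i = g * f' a + d * f' b := by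
    intro i
    have : f' i ∈ Ideal.span {f' a, f' b} := hspanab ▸ Ideal.subset_span ⟨i, rfl⟩
    obtain ⟨g, d, e⟩ := Ideal.mem_span_pair.1 this
    exact ⟨g, d, e.symm⟩
  choose g d hgd using hcoef
  let γ : ι → A := fun i => if i = a then 1 else if i = b then 0 else g i
  let δ : ι → A := fun i => if i = a then 0 else if i = b then 1 else d i
  have hf' : ∀ i, f' i = γ i * f' a + δ i * f' b := by
    intro i
    by_cases hia : i = a
    · subst hia; simp [γ, δ]
    · by_cases hib : i = b
      · subst hib; simp [γ, δ, hia]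
      · simp only [γ, δ, hia, hib, if_false]; exact hgd i
  have hfa : f' a ≠ 0 := fun e => hf0 a (hφ (by rw [map_zero]; exact e))
  have hK : ∀ u, f' a ∣ u * f' b → f' a ∣ u := by
    intro u hu
    have hdiv : ∀ i, f' a ∣ u * f' i := by
      intro i
      rw [hf' i, mul_add]
      exact dvd_add ⟨u * γ i, by ring⟩ (by
        have := hu.mul_left (δ i)
        rwa [show δ i * (u * f' b) = u * (δ i * f' b) by ring] at this)
    choose c hc using hdiv
    obtain ⟨t, ht, c₀, hc₀⟩ := exists_common_denom_ring P
      (fun i : Option ι => i.elim u c)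
    have : f a ∣ c₀ none := by
      refine hinv _ _ fun i => ⟨c₀ (some i), hφ ?_⟩
      rw [map_mul, map_mul, hc₀, hc₀]
      simp only [Option.elim]
      linear_combination φ t * hc i
    obtain ⟨e, he⟩ := this
    have h2 : φ t * u = f' a * φ e := by
      rw [← map_mul, ← he, hc₀]; rfl
    exact (IsUnit.dvd_mul_left (hunit t ht)).1 ⟨_, h2⟩
  have hM' : ∀ j, ∑ i, M' j i * f' i = 0 := fun j => by
    simp only [M', f', ← map_mul, ← map_sum, hM j, map_zero]
  have hspan' : ∀ w : ι → A, ∑ i, w i * f' i = 0 →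
      ∃ c : κ → A, w = fun i => ∑ j, c j * M' j i := by
    intro w hw
    obtain ⟨t, ht, w₀, hw₀⟩ := exists_common_denom_ring P w
    obtain ⟨c, hc⟩ := hspan w₀ (hφ (by
      rw [map_sum, map_zero, ← mul_zero (φ t), ← hw, Finset.mul_sum]
      exact Finset.sum_congr rfl fun i _ => by rw [map_mul, hw₀, mul_assoc]))
    obtain ⟨u, hu⟩ := hunit t ht
    refine ⟨fun j => ↑u⁻¹ * φ (c j), funext fun i => ?_⟩
    have h1 := hw₀ i
    rw [hc] at h1
    simp only [map_sum, map_mul] at h1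
    have h2 : w i = ↑u⁻¹ * (φ t * w i) := by rw [← hu, Units.inv_mul_cancel_left]
    rw [h2, ← h1, Finset.mul_sum]
    exact Finset.sum_congr rfl fun j _ => (mul_assoc _ _ _).symm
  have hind' : ∀ c : κ → A, (∀ i, ∑ j, c j * M' j i = 0) → c = 0 := by
    intro c hc
    obtain ⟨t, ht, c₀, hc₀⟩ := exists_common_denom_ring P c
    have h0 := hind c₀ (fun i => hφ (by
      rw [map_sum, map_zero, ← mul_zero (φ t), ← hc i, Finset.mul_sum]
      exact Finset.sum_congr rfl fun j _ => by rw [map_mul, hc₀, mul_assoc]))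
    funext j
    have h1 := hc₀ j
    rw [h0, Pi.zero_apply, map_zero] at h1
    exact (mul_eq_zero.1 h1.symm).resolve_left (hunit t ht).ne_zero
  obtain ⟨hT0, hT1⟩ := exact_of_pair hab hfa hf' hK (by simp [γ]) (by simp [δ])
    (by simp [γ, hab.symm]) (by simp [δ, hab.symm]) hM' hspan' hind'
  constructor
  · intro Q hQ
    have h0 : reesHom f' (MvPolynomial.map φ Q) = 0 := by
      rw [map_reesHom, hQ, Polynomial.map_zero]
    obtain ⟨c, hc⟩ := Ideal.mem_span_range_iff_exists_fun.1 (hT0 _ h0)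
    obtain ⟨t, ht, c₀, hc₀⟩ := exists_common_denom P c
    refine ⟨t, ht, Ideal.mem_span_range_iff_exists_fun.2 ⟨c₀, hmapinj ?_⟩⟩
    rw [map_mul, map_C, ← hc, map_sum, Finset.mul_sum]
    refine Finset.sum_congr rfl fun j _ => ?_
    rw [map_mul, map_linForm, hc₀ j, mul_assoc]
  · intro Q hQ
    obtain ⟨H, hH⟩ := hT1 (fun j => MvPolynomial.map φ (Q j)) (by
      have := congrArg (MvPolynomial.map φ) hQ
      simpa [map_linForm] using this)
    obtain ⟨t, ht, H₀, hH₀⟩ := exists_common_denom P (fun x : κ × κ => H x.1 x.2)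
    refine ⟨t, ht, fun j j' => H₀ (j, j'), fun j => hmapinj ?_⟩
    rw [map_mul, map_C, hH j (Finset.mem_univ j), map_sum, Finset.mul_sum]
    refine Finset.sum_congr rfl fun j' _ => ?_
    rw [map_mul, map_sub, map_linForm, hH₀, hH₀]
    ring

end AtPrime

section RegularTriple

/-- Three elements behaving like the coordinates at the origin of affine three-space. -/
structure IsRegularTriple {B : Type*} [CommRing B] (x : Fin 3 → B) : Prop where
  ne_zero : x 0 ≠ 0
  dvd_of_dvd_mul : ∀ u, x 0 ∣ u * x 1 → x 0 ∣ u
  mem_of_mul_mem : ∀ u, x 2 * u ∈ Ideal.span {x 0, x 1} → u ∈ Ideal.span {x 0, x 1}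
  mem_of_monomial_mem : ∀ (N : ℕ) (u : B), (x 0 * x 1 * x 2) ^ N * u ∈
    Ideal.span (Set.range fun l => x l ^ (N + 1)) → u ∈ Ideal.span (Set.range x)

theorem mem_of_forall_pow_mul_mem {B τ : Type*} [CommRing B] [Finite τ] {x : τ → B} {J : Ideal B}
    (hJ : ∀ h, (∀ l, x l * h ∈ J) → h ∈ J) {h : B} (hh : ∀ l, ∃ N : ℕ, x l ^ N * h ∈ J) :
    h ∈ J := by
  classical
  cases nonempty_fintype τ
  choose N hN using hh
  induction hn : ∑ l, N l generalizing N h with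
  | zero =>
    refine hJ h fun l => ?_
    have := hN l
    rw [Finset.sum_eq_zero_iff.1 hn l (Finset.mem_univ l), pow_zero, one_mul] at this
    exact Ideal.mul_mem_left _ _ this
  | succ n ih =>
    refine hJ h fun l => ?_
    rcases Nat.eq_zero_or_pos (N l) with h0 | h0
    · have := hN l
      rw [h0, pow_zero, one_mul] at this
      exact Ideal.mul_mem_left _ _ this
    · refine ih (Function.update N l (N l - 1)) (fun l' => ?_) ?_
      · by_cases e : l' = l
        · subst e
          rw [Function.update_self, ← mul_assoc, ← pow_succ, Nat.sub_add_cancel h0]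
          exact hN l'
        · rw [Function.update_of_ne e, mul_left_comm]
          exact Ideal.mul_mem_left _ _ (hN l')
      · rw [Finset.sum_update_of_mem (Finset.mem_univ l)]
        have := Finset.add_sum_erase Finset.univ N (Finset.mem_univ l)
        rw [Finset.sdiff_singleton_eq_erase]
        omega

namespace IsRegularTriple

variable {B : Type*} [CommRing B] [IsDomain B] {x : Fin 3 → B}

theorem exists_eq_mul (hx : IsRegularTriple x) {w : Fin 3 → B}
    (hw : ∀ l, x 0 * w l = x l * w 0) : ∃ h, ∀ l, w l = x l * h := by
  obtain ⟨h, hh⟩ := hx.dvd_of_dvd_mul (w 0) ⟨w 1, by rw [hw 1, mul_comm]⟩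
  refine ⟨h, fun l => mul_left_cancel₀ hx.ne_zero ?_⟩
  rw [hw l, hh]
  ring

theorem pow_dvd_of_pow_dvd_mul_pow (hx : IsRegularTriple x) {N N' : ℕ} {u : B}
    (h : x 0 ^ N ∣ u * x 1 ^ N') : x 0 ^ N ∣ u := by
  have one : ∀ (N : ℕ) (u : B), x 0 ^ N ∣ u * x 1 → x 0 ^ N ∣ u := by
    intro N
    induction N with
    | zero => simp
    | succ N ih =>
      intro u hu
      obtain ⟨v, rfl⟩ := hx.dvd_of_dvd_mul u ((dvd_pow_self _ N.succ_ne_zero).trans hu)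
      rw [pow_succ'] at hu ⊢
      rw [mul_assoc] at hu
      exact mul_dvd_mul_left _ (ih v ((mul_dvd_mul_iff_left hx.ne_zero).1 hu))
  induction N' with
  | zero => simpa using h
  | succ N' ih => exact ih (one N _ (by rwa [pow_succ, ← mul_assoc] at h))

theorem dvd_of_dvd_pow_mul (hx : IsRegularTriple x) {e r : B} {N N' : ℕ} (he : e ≠ 0)
    (h0 : e ∣ x 0 ^ N * r) (h1 : e ∣ x 1 ^ N' * r) : e ∣ r := by
  obtain ⟨c, hc⟩ := h0
  obtain ⟨d, hd⟩ := h1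
  have h : c * x 1 ^ N' = x 0 ^ N * d := by
    apply mul_left_cancel₀ he
    linear_combination x 0 ^ N * hd - x 1 ^ N' * hc
  obtain ⟨b, rfl⟩ := hx.pow_dvd_of_pow_dvd_mul_pow ⟨d, h⟩
  refine ⟨b, mul_left_cancel₀ (pow_ne_zero N hx.ne_zero) ?_⟩
  rw [hc]
  ring

theorem exists_eq_cross (hx : IsRegularTriple x) {a : Fin 3 → B} (ha : ∑ l, x l * a l = 0) :
    ∃ c : Fin 3 → B, ∀ l, a l = x (l + 1) * c (l + 2) - x (l + 2) * c (l + 1) := by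
  rw [Fin.sum_univ_three] at ha
  obtain ⟨u, v, huv⟩ := Ideal.mem_span_pair.1 (hx.mem_of_mul_mem (a 2)
    (Ideal.mem_span_pair.2 ⟨-a 0, -a 1, by linear_combination -ha⟩))
  obtain ⟨e, he⟩ := hx.dvd_of_dvd_mul (a 1 + v * x 2) ⟨-(a 0 + u * x 2), by
    linear_combination ha + x 2 * huv⟩
  have h0 : a 0 = - u * x 2 - e * x 1 := by
    apply mul_left_cancel₀ hx.ne_zero
    linear_combination ha - x 1 * he + x 2 * huv
  refine ⟨![-v, u, -e], fun l => ?_⟩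
  fin_cases l
  · simp [h0]
    ring
  · simp
    linear_combination he
  · simp
    linear_combination -huv

end IsRegularTriple

theorem exists_pow_mem_of_forall_prime {B : Type*} [CommRing B] [IsLocalRing B] {J : Ideal B}
    (h : ∀ P : Ideal B, P.IsPrime → P ≠ IsLocalRing.maximalIdeal B → ∃ s ∉ P, s ∈ J)
    {y : B} (hy : y ∈ IsLocalRing.maximalIdeal B) : ∃ N : ℕ, y ^ N ∈ J := by
  rw [← Ideal.mem_radical_iff, Ideal.radical_eq_sInf, Submodule.mem_sInf]
  rintro P ⟨hJP, hP⟩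
  by_cases hPm : P = IsLocalRing.maximalIdeal B
  · rwa [hPm]
  · obtain ⟨s, hs, hsJ⟩ := h P hP hPm
    exact absurd (hJP hsJ) hs

end RegularTriple

section Punctured

variable {B ι κ : Type*} [CommRing B] [IsDomain B] [IsLocalRing B] [Fintype ι] [DecidableEq ι]
  [Fintype κ] [DecidableEq κ] {f : ι → B} {M : κ → ι → B}

theorem exact_on_punctured [Nontrivial ι] (hf0 : ∀ i, f i ≠ 0)
    (hM : ∀ j, ∑ i, M j i * f i = 0)
    (hspan : ∀ w : ι → B, ∑ i, w i * f i = 0 → ∃ c : κ → B, w = fun i => ∑ j, c j * M j i)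
    (hind : ∀ c : κ → B, (∀ i, ∑ j, c j * M j i = 0) → c = 0)
    (hinv : ∀ a b : B, (∀ i, b ∣ a * f i) → b ∣ a)
    (hgood : ∀ P : Ideal B, P.IsPrime → P ≠ IsLocalRing.maximalIdeal B →
      ∃ p ∈ Ideal.span (Set.range f), ∃ q ∈ Ideal.span (Set.range f), ∃ s ∉ P,
        ∀ i, s * f i ∈ Ideal.span {p, q}) {y : B} (hy : y ∈ IsLocalRing.maximalIdeal B) :
    (∀ Q, reesHom f Q = 0 → ∃ N : ℕ,
      C (y ^ N) * Q ∈ Ideal.span (Set.range fun j => linForm (M j))) ∧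
      (∀ Q : κ → MvPolynomial ι B, ∑ j, Q j * linForm (M j) = 0 →
        ∃ N : ℕ, ∃ H : κ → κ → MvPolynomial ι B, ∀ j,
          C (y ^ N) * Q j = ∑ j', (H j j' - H j' j) * linForm (M j')) := by
  constructor
  · intro Q hQ
    refine exists_pow_mem_of_forall_prime
      (J := ((Ideal.span (Set.range fun j => linForm (M j))).colon {Q}).comap C)
      (fun P hP hPm => ?_) hy |>.imp fun N hN => ?_
    · obtain ⟨s, hs, h⟩ := (exact_at_prime hf0 hM hspan hind hinv P (hgood P hP hPm)).1 Q hQ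
      exact ⟨s, hs, by simpa [Submodule.mem_colon_singleton] using h⟩
    · simpa [Submodule.mem_colon_singleton] using hN
  · intro Q hQ
    let J : Ideal B :=
      { carrier := {s | ∃ H : κ → κ → MvPolynomial ι B, ∀ j,
          C s * Q j = ∑ j', (H j j' - H j' j) * linForm (M j')}
        zero_mem' := ⟨0, by simp⟩
        add_mem' := by
          rintro s t ⟨H, hH⟩ ⟨H', hH'⟩
          refine ⟨H + H', fun j => ?_⟩
          rw [map_add, add_mul, hH, hH', ← Finset.sum_add_distrib]
          exact Finset.sum_congr rfl fun _ _ => by simp only [Pi.add_apply]; ring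
        smul_mem' := by
          rintro c s ⟨H, hH⟩
          refine ⟨fun j j' => C c * H j j', fun j => ?_⟩
          rw [smul_eq_mul, map_mul, mul_assoc, hH, Finset.mul_sum]
          exact Finset.sum_congr rfl fun _ _ => by ring }
    exact exists_pow_mem_of_forall_prime (J := J) (fun P hP hPm =>
      (exact_at_prime hf0 hM hspan hind hinv P (hgood P hP hPm)).2 Q hQ) hy

end Punctured

section MinimalGenerators

theorem exists_minimal_generators {B V : Type*} [CommRing B] [IsLocalRing B] [AddCommGroup V]
    [Module B V] {N : Submodule B V} {p : V → Prop}
    (h : ∃ (r : ℕ) (L : Fin r → V), (∀ j, p (L j)) ∧ Submodule.span B (Set.range L) = N) :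
    ∃ (r : ℕ) (L : Fin r → V), (∀ j, p (L j)) ∧ Submodule.span B (Set.range L) = N ∧
      ∀ c : Fin r → B, ∑ j, c j • L j = 0 → ∀ j, c j ∈ IsLocalRing.maximalIdeal B := by
  classical
  obtain ⟨L, hp, hL⟩ := Nat.find_spec h
  refine ⟨_, L, hp, hL, fun c hc j => ?_⟩
  by_contra hj
  have hmin := fun {r} => Nat.find_min h (m := r)
  generalize Nat.find h = r at L hp hL c hc j hj hmin
  cases r with
  | zero => exact j.elim0
  | succ r =>
    refine hmin (Nat.lt_succ_self r) ⟨fun i => L (j.succAbove i), fun i => hp _, ?_⟩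
    rw [← hL]
    refine le_antisymm (Submodule.span_mono ?_) (Submodule.span_le.2 ?_)
    · rintro _ ⟨i, rfl⟩
      exact ⟨_, rfl⟩
    · rintro _ ⟨i, rfl⟩
      rcases Fin.eq_self_or_eq_succAbove j i with rfl | ⟨i, rfl⟩
      · obtain ⟨u, hu⟩ := by simpa [IsLocalRing.mem_maximalIdeal] using hj
        rw [Fin.sum_univ_succAbove _ i] at hc
        have : L i = -(u⁻¹ • ∑ l, c (i.succAbove l) • L (i.succAbove l)) := by
          rw [← smul_neg, eq_inv_smul_iff, Units.smul_def, hu]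
          exact eq_neg_of_add_eq_zero_left hc
        rw [this]
        refine neg_mem (Submodule.smul_mem _ (↑u⁻¹ : B) (Submodule.sum_mem _ fun l _ =>
          Submodule.smul_mem _ _ (Submodule.subset_span ⟨l, rfl⟩)))
      · exact Submodule.subset_span ⟨i, rfl⟩

end MinimalGenerators

section SignedMinors

variable {A : Type*} [CommRing A] {q : ℕ}

/-- The signed maximal minors of a matrix with one more column than rows. -/
def signedMinor (N : Fin q → Fin (q + 1) → A) (i : Fin (q + 1)) : A :=
  (-1) ^ (i : ℕ) * (Matrix.of N |>.submatrix id i.succAbove).det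

theorem sum_mul_signedMinor (N : Fin q → Fin (q + 1) → A) (v : Fin (q + 1) → A) :
    ∑ i, v i * signedMinor N i = (Matrix.of (Fin.cons v N : Fin (q + 1) → Fin (q + 1) → A)).det :=
        by
  rw [Matrix.det_succ_row_zero]
  refine Finset.sum_congr rfl fun i _ => ?_
  simp only [signedMinor, Matrix.of_apply, Fin.cons_zero]
  rw [← mul_assoc, mul_comm (v i)]
  rfl

theorem sum_row_mul_signedMinor (N : Fin q → Fin (q + 1) → A) (j : Fin q) :
    ∑ i, N j i * signedMinor N i = 0 := by
  rw [sum_mul_signedMinor]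
  refine Matrix.det_zero_of_row_eq (Fin.succ_ne_zero j).symm ?_
  ext i
  simp

theorem map_signedMinor {A' : Type*} [CommRing A'] (φ : A →+* A') (N : Fin q → Fin (q + 1) → A)
    (i : Fin (q + 1)) : φ (signedMinor N i) = signedMinor (fun j i => φ (N j i)) i := by
  simp only [signedMinor, map_mul, map_pow, map_neg, map_one, RingHom.map_det]
  rfl

end SignedMinors

section HilbertBurch

variable {B : Type*} [CommRing B] [IsDomain B] [IsLocalRing B] [IsNoetherianRing B]
  {x : Fin 3 → B} {q : ℕ} {f : Fin (q + 1) → B}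

theorem exists_hilbertBurch_matrix (hx : IsRegularTriple x)
    (hmax : IsLocalRing.maximalIdeal B = Ideal.span (Set.range x)) (hf0 : ∀ i, f i ≠ 0)
    (hmin : ∀ w : Fin (q + 1) → B, ∑ i, w i * f i = 0 → ∀ i, w i ∈ IsLocalRing.maximalIdeal B)
    (hsat : ∀ h, (∀ l, x l * h ∈ Ideal.span (Set.range f)) → h ∈ Ideal.span (Set.range f)) :
    ∃ M : Fin q → Fin (q + 1) → B, (∀ j i, M j i ∈ IsLocalRing.maximalIdeal B) ∧
      (∀ j, ∑ i, M j i * f i = 0) ∧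
      (∀ w : Fin (q + 1) → B, ∑ i, w i * f i = 0 →
        ∃ c : Fin q → B, w = fun i => ∑ j, c j * M j i) ∧
      ∀ c : Fin q → B, (∀ i, ∑ j, c j * M j i = 0) → c = 0 := by
  let F : (Fin (q + 1) → B) →ₗ[B] B := Fintype.linearCombination B f
  have hF : ∀ w, F w = ∑ i, w i * f i := fun w => by simp [F, Fintype.linearCombination_apply]
  obtain ⟨r, L, -, hL, hLmin⟩ := exists_minimal_generators (B := B) (N := LinearMap.ker F)
    (p := fun _ => True) (by
      obtain ⟨r, L, hL⟩ := Submodule.fg_iff_exists_fin_generating_family.1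
        (IsNoetherian.noetherian (LinearMap.ker F))
      exact ⟨r, L, fun _ => trivial, hL⟩)
  have hLF : ∀ j, F (L j) = 0 := fun j =>
    LinearMap.mem_ker.1 (hL ▸ Submodule.subset_span ⟨j, rfl⟩)
  have hspan : ∀ w, F w = 0 → ∃ c : Fin r → B, ∑ j, c j • L j = w := fun w hw =>
    (Submodule.mem_span_range_iff_exists_fun B).1 (hL.symm ▸ (LinearMap.mem_ker.2 hw))
  let G : (Fin r → B) →ₗ[B] (Fin (q + 1) → B) := Fintype.linearCombination B L
  have hG : ∀ c, G c = ∑ j, c j • L j := fun c => by simp [G, Fintype.linearCombination_apply]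
  have hrel : LinearMap.ker G = ⊥ := by
    refine Submodule.eq_bot_of_le_smul_of_le_jacobson_bot (IsLocalRing.maximalIdeal B) _
      (IsNoetherian.noetherian _) ?_ (IsLocalRing.jacobson_eq_maximalIdeal ⊥ bot_ne_top).ge
    intro p hp
    rw [LinearMap.mem_ker, hG] at hp
    have hmem : ∀ j, ∃ c : Fin 3 → B, ∑ l, c l * x l = p j := fun j =>
      Ideal.mem_span_range_iff_exists_fun.1 (hmax ▸ hLmin p hp j)
    choose P hP using hmem
    let R : Fin 3 → Fin (q + 1) → B := fun l => ∑ j, P j l • L j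
    have hFR : ∀ l, F (R l) = 0 := fun l => by simp [R, hLF]
    have hxR : ∀ i, ∑ l, x l * R l i = 0 := by
      intro i
      have := congrFun hp i
      simp only [Finset.sum_apply, Pi.smul_apply, smul_eq_mul, ← hP, Pi.zero_apply,
        Finset.sum_mul] at this
      rw [Finset.sum_comm] at this
      rw [← this]
      refine Finset.sum_congr rfl fun l _ => ?_
      simp only [R, Finset.sum_apply, Pi.smul_apply, smul_eq_mul, Finset.mul_sum]
      exact Finset.sum_congr rfl fun _ _ => by ring
    choose c hc using fun i => hx.exists_eq_cross (hxR i)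
    let W : Fin 3 → Fin (q + 1) → B := fun l i => c i l
    have hRW : ∀ l, R l = x (l + 1) • W (l + 2) - x (l + 2) • W (l + 1) := fun l => by
      ext i
      simp [W, hc]
    have hFW : ∀ l, x (l + 1) * F (W (l + 2)) = x (l + 2) * F (W (l + 1)) := by
      intro l
      have := hFR l
      rw [hRW, map_sub, map_smul, map_smul, smul_eq_mul, smul_eq_mul, sub_eq_zero] at this
      exact this
    obtain ⟨h, hh⟩ := hx.exists_eq_mul (w := fun l => F (W l)) (by
      intro l
      fin_cases l
      · rfl
      · exact hFW 2
      · exact (hFW 1).symm)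
    obtain ⟨w, hw⟩ := Ideal.mem_span_range_iff_exists_fun.1 (hsat h fun l => by
      rw [← hh l, hF]
      exact Ideal.sum_mem _ fun i _ => Ideal.mul_mem_left _ _ (Ideal.subset_span ⟨i, rfl⟩))
    have hFW' : ∀ l, F (W l - x l • w) = 0 := fun l => by
      rw [map_sub, map_smul, hF w, hw, hh l, smul_eq_mul, sub_self]
    choose v hv using fun l => hspan _ (hFW' l)
    let y : Fin 3 → Fin r → B := fun l => (fun j => P j l) - (x (l + 1) • v (l + 2) -
      x (l + 2) • v (l + 1))
    have hy : ∀ l, y l ∈ LinearMap.ker G := by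
      intro l
      rw [LinearMap.mem_ker]
      simp only [y, map_sub, map_smul]
      rw [hG, hG, hG, hv, hv]
      change R l - _ = 0
      rw [hRW, smul_sub, smul_sub, smul_smul, smul_smul, mul_comm (x (l + 2))]
      abel
    have hp' : p = ∑ l, x l • y l := by
      ext j
      rw [← hP j, Fin.sum_univ_three, Fin.sum_univ_three]
      simp [y]
      ring
    rw [hp']
    exact Submodule.sum_mem _ fun l _ =>
      Submodule.smul_mem_smul (hmax ▸ Ideal.subset_span ⟨l, rfl⟩) (hy l)
  have hker : Module.finrank B (LinearMap.ker F) = q := by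
    have h1 := Submodule.finrank_quotient_add_finrank (LinearMap.ker F)
    rw [F.quotKerEquivRange.finrank_eq] at h1
    have h2 : Module.finrank B (LinearMap.range F) = 1 := by
      have hne : (LinearMap.range F : Ideal B) ≠ ⊥ := by
        intro e
        have : f 0 ∈ (LinearMap.range F : Ideal B) := ⟨Pi.single 0 1, by
          rw [hF, Finset.sum_eq_single 0] <;> simp +contextual⟩
        rw [e] at this
        exact hf0 0 this
      apply le_antisymm
      · simpa using Submodule.finrank_le (LinearMap.range F)
      · have : Nontrivial (LinearMap.range F) := Submodule.nontrivial_iff_ne_bot.2 hne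
        exact Module.finrank_pos
    rw [h2, Module.finrank_fin_fun] at h1
    omega
  have hr : r = q := by
    have hinj := LinearMap.ker_eq_bot.1 hrel
    have hrange : LinearMap.range G = LinearMap.ker F := by
      rw [← hL, Fintype.range_linearCombination]
    have := LinearMap.finrank_range_of_inj hinj
    rw [hrange, hker, Module.finrank_fin_fun] at this
    exact this.symm
  subst hr
  refine ⟨L, fun j i => hmin _ (by rw [← hF]; exact hLF j) i, fun j => by rw [← hF]; exact hLF j,
    fun w hw => ?_, fun c hc => ?_⟩
  · obtain ⟨c, rfl⟩ := hspan w (by rw [hF]; exact hw)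
    exact ⟨c, by ext i; simp⟩
  · have : c ∈ LinearMap.ker G := by
      rw [LinearMap.mem_ker, hG]
      ext i
      simpa using hc i
    rw [hrel] at this
    exact this

end HilbertBurch

section MinorsProportional

theorem exists_signedMinor_eq {B : Type*} [CommRing B] [IsDomain B] {q : ℕ} {f : Fin (q + 1) → B}
    {M : Fin q → Fin (q + 1) → B} (hf0 : f 0 ≠ 0)
    (hspan : ∀ w : Fin (q + 1) → B, ∑ i, w i * f i = 0 →
        ∃ c : Fin q → B, w = fun i => ∑ j, c j * M j i)
    (hinv : ∀ a b : B, (∀ i, b ∣ a * f i) → b ∣ a) :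
    ∃ e ≠ 0, ∀ i, signedMinor M i = e * f i := by
  have hkos : ∀ i k, ∃ c : Fin q → B,
      (Pi.single i (f k) - Pi.single k (f i) : Fin (q + 1) → B) =
        fun l => ∑ j, c j * M j l := fun i k => hspan _ (by
    simp only [Pi.sub_apply, sub_mul, Finset.sum_sub_distrib, Pi.single_apply, ite_mul, zero_mul,
      Finset.sum_ite_eq', Finset.mem_univ, if_true]
    ring)
  have hcomm : ∀ i k, f k * signedMinor M i = f i * signedMinor M k := by
    intro i k
    obtain ⟨c, hc⟩ := hkos i k
    have h1 : ∑ l, (Pi.single i (f k) - Pi.single k (f i) : Fin (q + 1) → B) l *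
        signedMinor M l = 0 := by
      rw [hc]
      simp only [Finset.sum_mul, mul_assoc]
      rw [Finset.sum_comm]
      refine Finset.sum_eq_zero fun j _ => ?_
      rw [← Finset.mul_sum, sum_row_mul_signedMinor, mul_zero]
    simp only [Pi.sub_apply, sub_mul, Finset.sum_sub_distrib, Pi.single_apply, ite_mul, zero_mul,
      Finset.sum_ite_eq', Finset.mem_univ, if_true] at h1
    exact sub_eq_zero.1 h1
  obtain ⟨e, he⟩ := hinv (signedMinor M 0) (f 0) fun i => ⟨signedMinor M i, by
    rw [mul_comm, hcomm]⟩
  have hall : ∀ i, signedMinor M i = e * f i := fun i => by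
    apply mul_left_cancel₀ hf0
    rw [hcomm, he]
    ring
  refine ⟨e, ?_, hall⟩
  rintro rfl
  choose Z hZ using fun j : Fin q => hkos j.succ 0
  have hmul : (f 0 • (1 : Matrix (Fin q) (Fin q) B)) =
      Matrix.of Z * (Matrix.of M).submatrix id Fin.succ := by
    ext j l
    have := congrFun (hZ j) l.succ
    simp only [Matrix.mul_apply, Matrix.of_apply, Matrix.submatrix_apply, id]
    rw [← this]
    simp [Matrix.one_apply, Pi.single_apply, Fin.succ_ne_zero, eq_comm]
  have hdet := congrArg Matrix.det hmul
  have h0 : ((Matrix.of M).submatrix id Fin.succ).det = 0 := by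
    have := hall 0
    simpa [signedMinor] using this
  rw [Matrix.det_mul, h0, mul_zero, Matrix.det_smul, Matrix.det_one, mul_one] at hdet
  exact pow_ne_zero _ hf0 hdet

end MinorsProportional

section Deformation

theorem reesHom_of_isHomogeneous {A ι : Type*} [CommRing A] (f : ι → A) {m : ℕ}
    {E : MvPolynomial ι A} (hE : E.IsHomogeneous m) :
    reesHom f E = Polynomial.C (eval f E) * Polynomial.X ^ m := by
  conv_lhs => rw [E.as_sum]
  conv_rhs => rw [E.as_sum]
  simp only [map_sum, Finset.sum_mul]
  refine Finset.sum_congr rfl fun d hd => ?_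
  have hdeg := hE (mem_support_iff.1 hd)
  rw [reesHom, aeval_monomial, eval_monomial, ← hdeg, Finsupp.weight_apply]
  simp only [Finsupp.prod, Finsupp.sum, map_mul, map_prod, map_pow, mul_pow,
    Finset.prod_mul_distrib, mul_assoc, smul_eq_mul, mul_one, Pi.one_apply]
  rw [Finset.prod_pow_eq_pow_sum]
  rfl

theorem C_X_dvd_of_map_eq_zero {B ι : Type*} [CommRing B] {P : MvPolynomial ι (Polynomial B)}
    (h : MvPolynomial.map Polynomial.constantCoeff P = 0) :
    (C Polynomial.X : MvPolynomial ι (Polynomial B)) ∣ P := by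
  rw [C_dvd_iff_dvd_coeff]
  intro m
  rw [Polynomial.X_dvd_iff]
  have := congrArg (coeff m) h
  rwa [coeff_map, coeff_zero] at this

theorem map_constantCoeff_map_C {B ι : Type*} [CommRing B] (P : MvPolynomial ι B) :
    MvPolynomial.map Polynomial.constantCoeff (MvPolynomial.map Polynomial.C P) = P := by
  rw [MvPolynomial.map_map]
  convert MvPolynomial.map_id P
  ext
  simp

theorem sum_sum_sub_mul_mul {S κ : Type*} [CommRing S] [Fintype κ] (H : κ → κ → S) (L : κ → S) :
    ∑ j, (∑ j', (H j j' - H j' j) * L j') * L j = 0 := by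
  simp only [sub_mul, Finset.sum_sub_distrib, Finset.sum_mul]
  rw [sub_eq_zero, Finset.sum_comm]
  exact Finset.sum_congr rfl fun _ _ => Finset.sum_congr rfl fun _ _ => by ring

variable {B ι κ : Type*} [CommRing B] [IsDomain B] [Fintype ι] [Fintype κ]
  {M : κ → ι → B} {d : ι → B} {M' : κ → ι → Polynomial B} {d' : ι → Polynomial B}

omit [IsDomain B] [Fintype κ] in
theorem map_linForm_deformation (hM' : ∀ j i, Polynomial.constantCoeff (M' j i) = M j i) (j : κ) :
    MvPolynomial.map Polynomial.constantCoeff (linForm (M' j)) = linForm (M j) := by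
  rw [map_linForm]
  congr 1
  ext i
  exact hM' j i

theorem deformation_rees {y : B} (hM' : ∀ j i, Polynomial.constantCoeff (M' j i) = M j i)
    (hd' : ∀ i, Polynomial.constantCoeff (d' i) = d i) (hMd : ∀ j, ∑ i, M' j i * d' i = 0)
    (h : ∀ Q, reesHom d Q = 0 → ∃ N : ℕ,
      C (y ^ N) * Q ∈ Ideal.span (Set.range fun j => linForm (M j)))
    (K : ℕ) (Q : MvPolynomial ι (Polynomial B))
    (hQ : Polynomial.C (Polynomial.X ^ K) ∣ reesHom d' Q) :
    ∃ (N : ℕ) (c : κ → MvPolynomial ι (Polynomial B)) (R : MvPolynomial ι (Polynomial B)),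
      C (Polynomial.C (y ^ N)) * Q =
        ∑ j, c j * linForm (M' j) + C (Polynomial.X ^ K) * R := by
  induction K generalizing Q with
  | zero => exact ⟨0, 0, Q, by simp⟩
  | succ K ih =>
    have h0 : reesHom d (MvPolynomial.map Polynomial.constantCoeff Q) = 0 := by
      have := map_reesHom Polynomial.constantCoeff d' Q
      simp only [hd'] at this
      rw [this]
      obtain ⟨Q', hQ'⟩ := hQ
      rw [hQ', Polynomial.map_mul, Polynomial.map_C]
      simp
    obtain ⟨N, hN⟩ := h _ h0
    obtain ⟨c, hc⟩ := Ideal.mem_span_range_iff_exists_fun.1 hN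
    obtain ⟨Q₁, hQ₁⟩ := C_X_dvd_of_map_eq_zero
      (P := C (Polynomial.C (y ^ N)) * Q - ∑ j, MvPolynomial.map Polynomial.C (c j) *
        linForm (M' j)) (by
        rw [map_sub, map_mul, map_C, map_sum, sub_eq_zero]
        simp only [map_mul, map_constantCoeff_map_C, map_linForm_deformation hM', hc]
        rw [Polynomial.constantCoeff_apply, Polynomial.coeff_C_zero])
    have hrees := congrArg (reesHom d') hQ₁
    simp only [map_sub, map_mul, map_sum, reesHom_C, reesHom_linForm, hMd, map_zero, zero_mul,
      mul_zero, Finset.sum_const_zero, sub_zero] at hrees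
    obtain ⟨N', c', R', hR'⟩ := ih Q₁ (by
      have h1 := hQ.mul_left (Polynomial.C (Polynomial.C (y ^ N)))
      rw [hrees, pow_succ', map_mul] at h1
      exact (mul_dvd_mul_iff_left (Polynomial.C_ne_zero.2 Polynomial.X_ne_zero)).1 h1)
    refine ⟨N' + N, fun j => C (Polynomial.C (y ^ N')) * MvPolynomial.map Polynomial.C (c j) +
      C Polynomial.X * c' j, R', ?_⟩
    simp only [add_mul, Finset.sum_add_distrib, mul_assoc, ← Finset.mul_sum]
    simp only [pow_add, pow_one, map_mul] at hQ₁ ⊢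
    linear_combination C (Polynomial.C (y ^ N')) * hQ₁ + C Polynomial.X * hR'

theorem deformation_koszul {y : B} (hM' : ∀ j i, Polynomial.constantCoeff (M' j i) = M j i)
    (h : ∀ Q : κ → MvPolynomial ι B, ∑ j, Q j * linForm (M j) = 0 →
        ∃ N : ℕ, ∃ H : κ → κ → MvPolynomial ι B, ∀ j,
          C (y ^ N) * Q j = ∑ j', (H j j' - H j' j) * linForm (M j'))
    (K : ℕ) (Q : κ → MvPolynomial ι (Polynomial B))
    (hQ : C (Polynomial.X ^ K) ∣ ∑ j, Q j * linForm (M' j)) :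
    ∃ (N : ℕ) (H : κ → κ → MvPolynomial ι (Polynomial B)) (R : κ → MvPolynomial ι (Polynomial B)),
      ∀ j, C (Polynomial.C (y ^ N)) * Q j =
        ∑ j', (H j j' - H j' j) * linForm (M' j') + C (Polynomial.X ^ K) * R j := by
  induction K generalizing Q with
  | zero => exact ⟨0, 0, Q, by simp⟩
  | succ K ih =>
    obtain ⟨N, H, hH⟩ := h (fun j => MvPolynomial.map Polynomial.constantCoeff (Q j)) (by
      obtain ⟨Q', hQ'⟩ := hQ
      have := congrArg (MvPolynomial.map Polynomial.constantCoeff) hQ'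
      simpa [map_linForm_deformation hM'] using this)
    let H₀ : κ → κ → MvPolynomial ι (Polynomial B) :=
        fun j j' => MvPolynomial.map Polynomial.C (H j j')
    have hdvd : ∀ j, (C Polynomial.X : MvPolynomial ι (Polynomial B)) ∣
        C (Polynomial.C (y ^ N)) * Q j - ∑ j', (H₀ j j' - H₀ j' j) * linForm (M' j') := by
      intro j
      refine C_X_dvd_of_map_eq_zero ?_
      rw [map_sub, map_mul, map_C, map_sum, sub_eq_zero]
      simp only [H₀, map_mul, map_sub, map_constantCoeff_map_C, map_linForm_deformation hM', ← hH]
      rw [Polynomial.constantCoeff_apply, Polynomial.coeff_C_zero]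
    choose Q₁ hQ₁ using hdvd
    have hsum : C (Polynomial.C (y ^ N)) * ∑ j, Q j * linForm (M' j) =
        C Polynomial.X * ∑ j, Q₁ j * linForm (M' j) := by
      have h1 : ∑ j, (C (Polynomial.C (y ^ N)) * Q j -
          ∑ j', (H₀ j j' - H₀ j' j) * linForm (M' j')) * linForm (M' j) =
          C Polynomial.X * ∑ j, Q₁ j * linForm (M' j) := by
        rw [Finset.mul_sum]
        exact Finset.sum_congr rfl fun j _ => by rw [hQ₁, mul_assoc]
      rw [← h1, Finset.sum_congr rfl fun j _ => sub_mul _ _ _, Finset.sum_sub_distrib,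
        sum_sum_sub_mul_mul, sub_zero, Finset.mul_sum]
      exact Finset.sum_congr rfl fun j _ => (mul_assoc _ _ _).symm
    obtain ⟨N', H', R', hR'⟩ := ih Q₁ (by
      have h1 := hQ.mul_left (C (Polynomial.C (y ^ N)))
      rw [hsum, pow_succ', map_mul] at h1
      exact (mul_dvd_mul_iff_left ((C_ne_zero (σ := ι)).2 Polynomial.X_ne_zero)).1 h1)
    refine ⟨N' + N, fun j j' => C (Polynomial.C (y ^ N')) * H₀ j j' + C Polynomial.X * H' j j', R',
      fun j => ?_⟩
    have e1 : ∑ j', (C (Polynomial.C (y ^ N')) * H₀ j j' + C Polynomial.X * H' j j' -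
        (C (Polynomial.C (y ^ N')) * H₀ j' j + C Polynomial.X * H' j' j)) * linForm (M' j') =
        C (Polynomial.C (y ^ N')) * ∑ j', (H₀ j j' - H₀ j' j) * linForm (M' j') +
        C Polynomial.X * ∑ j', (H' j j' - H' j' j) * linForm (M' j') := by
      rw [Finset.mul_sum, Finset.mul_sum, ← Finset.sum_add_distrib]
      exact Finset.sum_congr rfl fun _ _ => by ring
    rw [e1]
    simp only [pow_add, pow_one, map_mul]
    linear_combination C (Polynomial.C (y ^ N')) * hQ₁ j + C Polynomial.X * hR' j

end Deformation

section Saturation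

theorem reesHom_mul_left_eq_zero {A ι : Type*} [CommRing A] [IsDomain A] {e : A} (he : e ≠ 0)
    {f : ι → A} {Q : MvPolynomial ι A} (hQ : reesHom (fun i => e * f i) Q = 0) :
    reesHom f Q = 0 := by
  have h1 : reesHom (fun i => e * f i) =
      (Polynomial.aeval (Polynomial.C e * Polynomial.X)).comp (reesHom f) := by
    ext i : 1
    simp only [AlgHom.comp_apply, reesHom_X, map_mul, Polynomial.aeval_C, Polynomial.aeval_X]
    simp only [Polynomial.algebraMap_eq]
    ring
  rw [h1, AlgHom.comp_apply, ← Polynomial.comp_eq_aeval] at hQ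
  exact (Polynomial.comp_C_mul_X_eq_zero_iff (mem_nonZeroDivisors_of_ne_zero he)).1 hQ

theorem coeff_reesHom_mem {A ι : Type*} [CommRing A] (f : ι → A) (Q : MvPolynomial ι A) (m : ℕ) :
    (reesHom f Q).coeff m ∈ Ideal.span (Set.range f) ^ m := by
  have h1 : reesHom f Q ∈ reesAlgebra (Ideal.span (Set.range f)) := by
    have h2 : (reesHom f).range ≤ reesAlgebra (Ideal.span (Set.range f)) := by
      rw [reesHom, ← Algebra.adjoin_range_eq_range_aeval, Algebra.adjoin_le_iff]
      rintro _ ⟨i, rfl⟩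
      simp only [SetLike.mem_coe, mem_reesAlgebra_iff, Polynomial.coeff_C_mul_X]
      intro j
      split_ifs with h
      · rw [h, pow_one]
        exact Ideal.subset_span ⟨i, rfl⟩
      · exact zero_mem _
    exact h2 ⟨Q, rfl⟩
  exact (mem_reesAlgebra_iff _ _).1 h1 m

namespace IsRegularTriple

theorem mem_span_range_mul_pow {B ι : Type*} [CommRing B] [IsDomain B] {x : Fin 3 → B}
    (hx : IsRegularTriple x) {e : B} (he : e ≠ 0) {f : ι → B} {m : ℕ}
    (hsat : ∀ h, (∀ l, x l * h ∈ Ideal.span (Set.range f) ^ m) → h ∈ Ideal.span (Set.range f) ^ m)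
    {r : B} (hr : ∀ l, ∃ N, x l ^ N * r ∈ Ideal.span (Set.range fun i => e * f i) ^ m) :
    r ∈ Ideal.span (Set.range fun i => e * f i) ^ m := by
  have hpow : Ideal.span (Set.range fun i => e * f i) ^ m =
      Ideal.span {e ^ m} * Ideal.span (Set.range f) ^ m := by
    rw [← Ideal.span_singleton_pow, ← mul_pow, Ideal.span_mul_span']
    congr 2
    ext b
    simp
  simp only [hpow, Ideal.mem_span_singleton_mul] at hr ⊢
  obtain ⟨N₀, z₀, -, h₀⟩ := hr 0
  obtain ⟨N₁, z₁, -, h₁⟩ := hr 1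
  obtain ⟨r', rfl⟩ := hx.dvd_of_dvd_pow_mul (pow_ne_zero m he) ⟨z₀, h₀.symm⟩ ⟨z₁, h₁.symm⟩
  refine ⟨r', mem_of_forall_pow_mul_mem hsat fun l => ?_, rfl⟩
  obtain ⟨N, z, hz, h⟩ := hr l
  refine ⟨N, ?_⟩
  have : z = x l ^ N * r' := by
    apply mul_left_cancel₀ (pow_ne_zero m he)
    rw [h]
    ring
  rwa [← this]

end IsRegularTriple

theorem deformation_saturated {B ι κ τ : Type*} [CommRing B] [IsDomain B] [Fintype ι] [Fintype κ]
    {M : κ → ι → B} {d : ι → B} {M' : κ → ι → Polynomial B} {d' : ι → Polynomial B} {x : τ → B}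
    (hM' : ∀ j i, Polynomial.constantCoeff (M' j i) = M j i)
    (hd' : ∀ i, Polynomial.constantCoeff (d' i) = d i) (hMd : ∀ j, ∑ i, M' j i * d' i = 0)
    (h : ∀ l Q, reesHom d Q = 0 → ∃ N : ℕ,
      C (x l ^ N) * Q ∈ Ideal.span (Set.range fun j => linForm (M j)))
    {m : ℕ} (hsat : ∀ r, (∀ l, ∃ N : ℕ, x l ^ N * r ∈ Ideal.span (Set.range d) ^ m) →
      r ∈ Ideal.span (Set.range d) ^ m)
    (K : ℕ) (r : Polynomial B)
    (hr : ∀ l, ∃ N : ℕ, Polynomial.C (x l ^ N) * r ∈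
      Ideal.span (Set.range d') ^ m ⊔ Ideal.span {Polynomial.X ^ K}) :
    r ∈ Ideal.span (Set.range d') ^ m ⊔ Ideal.span {Polynomial.X ^ K} := by
  induction K generalizing r with
  | zero => simp
  | succ K ih =>
    have hd : (fun i => Polynomial.constantCoeff (d' i)) = d := funext hd'
    simp only [Submodule.mem_sup, Ideal.mem_span_singleton] at hr
    have hcc : ∀ b : B, Polynomial.constantCoeff (Polynomial.C b) = b := fun b =>
      Polynomial.coeff_C_zero
    have h0 : Polynomial.constantCoeff r ∈ Ideal.span (Set.range d) ^ m := by
      refine hsat _ fun l => ?_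
      obtain ⟨N, u, hu, _, ⟨c, rfl⟩, hur⟩ := hr l
      refine ⟨N, ?_⟩
      have h1 := Ideal.mem_map_of_mem Polynomial.constantCoeff hu
      rw [Ideal.map_pow, Ideal.map_span, ← Set.range_comp] at h1
      have h2 := congrArg Polynomial.constantCoeff hur
      rw [map_add, map_mul, map_mul, hcc, pow_succ', map_mul,
          Polynomial.constantCoeff_apply Polynomial.X,
        Polynomial.coeff_X_zero, zero_mul, zero_mul, add_zero] at h2
      rw [← h2, ← hd]
      exact h1
    obtain ⟨E, hE, hEr⟩ := (Ideal.mem_span_pow_iff_exists_isHomogeneous _ _).1 h0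
    have hE' := hE.map Polynomial.C
    set E' : MvPolynomial ι (Polynomial B) := MvPolynomial.map Polynomial.C E with hE'_def
    have hEd : Polynomial.constantCoeff (eval d' E') = Polynomial.constantCoeff r := by
      rw [← hEr, hE'_def, eval_map, ← coe_eval₂Hom, ← RingHom.comp_apply]
      congr 1
      ext <;> simp [hd', hcc]
    obtain ⟨r₁, hr₁⟩ : Polynomial.X ∣ r - eval d' E' := by
      rw [Polynomial.X_dvd_iff, ← Polynomial.constantCoeff_apply, map_sub, hEd, sub_self]
    have hmem : r₁ ∈ Ideal.span (Set.range d') ^ m ⊔ Ideal.span {Polynomial.X ^ K} := by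
      refine ih r₁ fun l => ?_
      obtain ⟨N, u, hu, _, ⟨c, rfl⟩, hur⟩ := hr l
      obtain ⟨G, hG, rfl⟩ := (Ideal.mem_span_pow_iff_exists_isHomogeneous _ _).1 hu
      set F := G - C (Polynomial.C (x l ^ N)) * E' with hF
      have hFm : F.IsHomogeneous m := hG.sub (hE'.C_mul _)
      have hFe : eval d' F =
          Polynomial.X * (Polynomial.C (x l ^ N) * r₁ - Polynomial.X ^ K * c) := by
        rw [hF, map_sub, map_mul, eval_C]
        linear_combination hur + Polynomial.C (x l ^ N) * hr₁
      obtain ⟨N', a, R, hR⟩ := deformation_rees hM' hd' hMd (h l) 1 F (by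
        rw [reesHom_of_isHomogeneous d' hFm, hFe, pow_one, map_mul, mul_assoc]
        exact dvd_mul_right _ _)
      have h1 := congrArg (fun P => (reesHom d' P).coeff m) hR
      simp only [map_add, map_mul, map_sum, reesHom_C, reesHom_linForm, hMd, map_zero, zero_mul,
        mul_zero, Finset.sum_const_zero, zero_add, reesHom_of_isHomogeneous d' hFm, hFe, pow_one,
        Polynomial.coeff_C_mul, Polynomial.coeff_X_pow_self, mul_one, mul_assoc] at h1
      refine ⟨N' + N, Submodule.mem_sup.2 ⟨_, coeff_reesHom_mem d' R m, _,
        Ideal.mem_span_singleton.2 ⟨Polynomial.C (x l ^ N') * c, rfl⟩, ?_⟩⟩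
      apply mul_left_cancel₀ (Polynomial.X_ne_zero (R := B))
      rw [pow_add, map_mul]
      linear_combination - h1
    obtain ⟨u, hu, _, hc, hur⟩ := Submodule.mem_sup.1 hmem
    obtain ⟨c, rfl⟩ := Ideal.mem_span_singleton.1 hc
    refine Submodule.mem_sup.2 ⟨eval d' E' + Polynomial.X * u, Ideal.add_mem _
      ((Ideal.mem_span_pow_iff_exists_isHomogeneous _ _).2 ⟨E', hE', rfl⟩)
      (Ideal.mul_mem_left _ _ hu), Polynomial.X ^ (K + 1) * c,
      Ideal.mem_span_singleton.2 ⟨c, rfl⟩, ?_⟩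
    linear_combination Polynomial.X * hur - hr₁

end Saturation

section Zigzag

theorem isHomogeneous_linForm {A ι : Type*} [CommRing A] [Fintype ι] (w : ι → A) :
    (linForm w).IsHomogeneous 1 :=
  IsHomogeneous.sum _ _ _ fun i _ => by
    simpa using (isHomogeneous_C ι (w i)).mul (isHomogeneous_X A i)

theorem eval_linForm {A ι : Type*} [CommRing A] [Fintype ι] (w d : ι → A) :
    eval d (linForm w) = ∑ i, w i * d i := by
  simp [linForm]

theorem IsRegularTriple.exists_eq_C_mul {B : Type*} [CommRing B] [IsDomain B] {x : Fin 3 → B}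
    (hx : IsRegularTriple x) {w : Fin 3 → Polynomial B}
    (hw : ∀ l, Polynomial.C (x 0) * w l = Polynomial.C (x l) * w 0) :
    ∃ h, ∀ l, w l = Polynomial.C (x l) * h := by
  obtain ⟨h, hh⟩ : Polynomial.C (x 0) ∣ w 0 := by
    rw [Polynomial.C_dvd_iff_dvd_coeff]
    intro n
    obtain ⟨h, hh⟩ := hx.exists_eq_mul (w := fun l => (w l).coeff n) fun l => by
      have := congrArg (fun P => Polynomial.coeff P n) (hw l)
      simpa using this
    exact ⟨h, hh 0⟩
  refine ⟨h, fun l => mul_left_cancel₀ (Polynomial.C_ne_zero.2 hx.ne_zero) ?_⟩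
  rw [hw, hh]
  ring

theorem deformation_zigzag {B ι κ : Type*} [CommRing B] [IsDomain B] [Fintype ι] [Fintype κ]
    [DecidableEq κ] {x : Fin 3 → B} (hx : IsRegularTriple x)
    {M : κ → ι → Polynomial B} {d : ι → Polynomial B} (hMd : ∀ j, ∑ i, M j i * d i = 0)
    {m : ℕ} {K : ℕ}
    (hrees : ∀ l Q, Polynomial.C (Polynomial.X ^ K) ∣ reesHom d Q →
      ∃ (N : ℕ) (c : κ → MvPolynomial ι (Polynomial B)) (R : MvPolynomial ι (Polynomial B)),
        C (Polynomial.C (x l ^ N)) * Q = ∑ j, c j * linForm (M j) + C (Polynomial.X ^ K) * R)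
    (hkos : ∀ (l) (Q : κ → MvPolynomial ι (Polynomial B)),
      C (Polynomial.X ^ K) ∣ ∑ j, Q j * linForm (M j) →
      ∃ (N : ℕ) (H : κ → κ → MvPolynomial ι (Polynomial B))
        (R : κ → MvPolynomial ι (Polynomial B)), ∀ j, C (Polynomial.C (x l ^ N)) * Q j =
          ∑ j', (H j j' - H j' j) * linForm (M j') + C (Polynomial.X ^ K) * R j)
    (hsat : ∀ r, (∀ l, ∃ N : ℕ, Polynomial.C (x l ^ N) * r ∈
        Ideal.span (Set.range d) ^ (m + 2) ⊔ Ideal.span {Polynomial.X ^ K}) →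
      r ∈ Ideal.span (Set.range d) ^ (m + 2) ⊔ Ideal.span {Polynomial.X ^ K})
    {a b : κ} (hab : a ≠ b) {Na Nb : Fin 3 → ι → Polynomial B}
    (ha : ∀ i, M a i = ∑ l, Polynomial.C (x l) * Na l i)
    (hb : ∀ i, M b i = ∑ l, Polynomial.C (x l) * Nb l i) (e : ι) :
    ∃ (N : ℕ) (G : Fin 3 → κ → MvPolynomial ι (Polynomial B))
      (R : Fin 3 → MvPolynomial ι (Polynomial B)), (∀ r, G r a = 0) ∧
      C (Polynomial.C ((x 0 * x 1 * x 2) ^ N)) * X e ^ m * linForm (M b) =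
        ∑ r, C (Polynomial.C (x r ^ (N + 1))) *
          (∑ j, G r j * linForm (M j) + C (Polynomial.X ^ K) * R r) := by
  set z : Fin 3 → MvPolynomial ι (Polynomial B) := fun l => C (Polynomial.C (x l)) with hz
  have hzp : ∀ l N, C (Polynomial.C (x l ^ N)) = z l ^ N := fun l N => by simp [hz]
  simp only [hzp] at hrees hkos ⊢
  set α := fun l => linForm (Na l) with hα
  set β := fun l => linForm (Nb l) with hβ
  have hLa : linForm (M a) = z 0 * α 0 + z 1 * α 1 + z 2 * α 2 := by
    simp only [hα, hz, linForm, ha, Finset.mul_sum, ← Finset.sum_add_distrib, Fin.sum_univ_three]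
    refine Finset.sum_congr rfl fun i _ => ?_
    simp only [map_add, map_mul]
    ring
  have hLb : linForm (M b) = z 0 * β 0 + z 1 * β 1 + z 2 * β 2 := by
    simp only [hβ, hz, linForm, hb, Finset.mul_sum, ← Finset.sum_add_distrib, Fin.sum_univ_three]
    refine Finset.sum_congr rfl fun i _ => ?_
    simp only [map_add, map_mul]
    ring
  set w : Fin 3 → MvPolynomial ι (Polynomial B) :=
    fun l => α (l + 1) * β (l + 2) - α (l + 2) * β (l + 1) with hw
  have hcross : ∀ r, z (r + 1) * w (r + 2) - z (r + 2) * w (r + 1) =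
      α r * linForm (M b) - β r * linForm (M a) := by
    intro r
    rw [hLa, hLb]
    fin_cases r <;> simp [hw] <;> ring
  have hα1 : ∀ l, (α l).IsHomogeneous 1 := fun l => isHomogeneous_linForm _
  have hβ1 : ∀ l, (β l).IsHomogeneous 1 := fun l => isHomogeneous_linForm _
  have hw2 : ∀ l, (w l).IsHomogeneous 2 := fun l =>
    ((hα1 _).mul (hβ1 _)).sub ((hα1 _).mul (hβ1 _))
  have hcross_eval : ∀ r, Polynomial.C (x (r + 1)) * eval d (w (r + 2)) =
      Polynomial.C (x (r + 2)) * eval d (w (r + 1)) := by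
    intro r
    have := congrArg (eval d) (hcross r)
    rw [map_sub, map_sub, map_mul, map_mul, map_mul, map_mul, eval_linForm (M b),
      eval_linForm (M a), hMd, hMd, mul_zero, mul_zero, sub_zero, hz, eval_C, eval_C] at this
    exact sub_eq_zero.1 this
  obtain ⟨h, hh⟩ := hx.exists_eq_C_mul (w := fun l => eval d (w l)) (by
    intro l
    fin_cases l
    · rfl
    · exact hcross_eval 2
    · exact (hcross_eval 1).symm)
  have hwX : ∀ l, (w l * X e ^ m).IsHomogeneous (m + 2) := fun l => by
    simpa [add_comm] using (hw2 l).mul ((isHomogeneous_X (Polynomial B) e).pow m)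
  have hmem := hsat (h * d e ^ m) fun l => ⟨1, Submodule.mem_sup_left
    ((Ideal.mem_span_pow_iff_exists_isHomogeneous _ _).2 ⟨w l * X e ^ m, hwX l, by
      rw [map_mul, hh, map_pow, eval_X, pow_one, mul_assoc]⟩)⟩
  obtain ⟨_, hP, _, hc, hPc⟩ := Submodule.mem_sup.1 hmem
  obtain ⟨P, hPm, rfl⟩ := (Ideal.mem_span_pow_iff_exists_isHomogeneous _ _).1 hP
  obtain ⟨c₀, rfl⟩ := Ideal.mem_span_singleton.1 hc
  set E := fun l => z l * P - w l * X e ^ m with hE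
  have hEm : ∀ l, (E l).IsHomogeneous (m + 2) := fun l => (hPm.C_mul _).sub (hwX l)
  have hErees : ∀ l, Polynomial.C (Polynomial.X ^ K) ∣ reesHom d (E l) := by
    intro l
    rw [reesHom_of_isHomogeneous d (hEm l)]
    refine Dvd.dvd.mul_right (Polynomial.C.map_dvd ⟨- (Polynomial.C (x l) * c₀), ?_⟩) _
    simp only [hE, hz, map_sub, map_mul, map_pow, eval_C, eval_X, hh]
    linear_combination Polynomial.C (x l) * hPc
  choose N₀ c₁ R₁ hE₁ using fun l => hrees l (E l) (hErees l)
  obtain ⟨N, c, R, hEN⟩ : ∃ (N : ℕ) (c : Fin 3 → κ → MvPolynomial ι (Polynomial B))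
      (R : Fin 3 → MvPolynomial ι (Polynomial B)), ∀ l, z l ^ N * E l =
        ∑ j, c l j * linForm (M j) + C (Polynomial.X ^ K) * R l := by
    refine ⟨∑ l, N₀ l, fun l j => z l ^ (∑ i, N₀ i - N₀ l) * c₁ l j,
      fun l => z l ^ (∑ i, N₀ i - N₀ l) * R₁ l, fun l => ?_⟩
    have hle : N₀ l ≤ ∑ i, N₀ i := Finset.single_le_sum (fun _ _ => Nat.zero_le _)
      (Finset.mem_univ l)
    simp only [mul_assoc, ← Finset.mul_sum]
    conv_lhs => rw [← Nat.sub_add_cancel hle, pow_add]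
    linear_combination z l ^ (∑ i, N₀ i - N₀ l) * hE₁ l
  set ρ : Fin 3 → κ → MvPolynomial ι (Polynomial B) := fun r j =>
    z (r + 1) ^ (N + 1) * c (r + 2) j - z (r + 2) ^ (N + 1) * c (r + 1) j +
      z (r + 1) ^ N * z (r + 2) ^ N * X e ^ m *
        ((if j = b then α r else 0) - (if j = a then β r else 0)) with hρ
  have hρL : ∀ r, C (Polynomial.X ^ K) ∣ ∑ j, ρ r j * linForm (M j) := by
    intro r
    have h1 : ∑ j, ρ r j * linForm (M j) =
        z (r + 1) ^ (N + 1) * ∑ j, c (r + 2) j * linForm (M j) -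
        z (r + 2) ^ (N + 1) * ∑ j, c (r + 1) j * linForm (M j) +
        z (r + 1) ^ N * z (r + 2) ^ N * X e ^ m *
          (α r * linForm (M b) - β r * linForm (M a)) := by
      simp only [hρ, add_mul, sub_mul, mul_sub, Finset.sum_add_distrib, Finset.sum_sub_distrib,
        mul_assoc, ite_mul, mul_ite, zero_mul, mul_zero, Finset.sum_ite_eq', Finset.mem_univ,
        if_true, Finset.mul_sum]
    refine ⟨z (r + 2) ^ (N + 1) * R (r + 1) - z (r + 1) ^ (N + 1) * R (r + 2), ?_⟩
    rw [h1, ← hcross r]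
    have h2 := hEN (r + 1)
    have h3 := hEN (r + 2)
    simp only [hE] at h2 h3
    linear_combination z (r + 2) ^ (N + 1) * h2 - z (r + 1) ^ (N + 1) * h3
  choose N₂ H₂ R₂ hH₂ using fun r => hkos (r + 1) (ρ r) (hρL r)
  obtain ⟨N', H, R', hH⟩ : ∃ (N' : ℕ) (H : Fin 3 → κ → MvPolynomial ι (Polynomial B))
      (R : Fin 3 → MvPolynomial ι (Polynomial B)), ∀ r, H r a = 0 ∧ z (r + 1) ^ N' * ρ r a =
        ∑ j, H r j * linForm (M j) + C (Polynomial.X ^ K) * R r := by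
    refine ⟨∑ l, N₂ l, fun r j => z (r + 1) ^ (∑ i, N₂ i - N₂ r) * (H₂ r a j - H₂ r j a),
      fun r => z (r + 1) ^ (∑ i, N₂ i - N₂ r) * R₂ r a, fun r => ⟨by simp, ?_⟩⟩
    have hle : N₂ r ≤ ∑ i, N₂ i := Finset.single_le_sum (fun _ _ => Nat.zero_le _)
      (Finset.mem_univ r)
    simp only [mul_assoc, ← Finset.mul_sum]
    conv_lhs => rw [← Nat.sub_add_cancel hle, pow_add]
    linear_combination z (r + 1) ^ (∑ i, N₂ i - N₂ r) * hH₂ r a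
  refine ⟨N + N', fun r j => - (z (r + 2) ^ N' * H r j), fun r => - (z (r + 2) ^ N' * R' r),
    fun r => by simp [(hH r).1], ?_⟩
  have h1 : ∀ r, z r ^ (N + N' + 1) * (∑ j, - (z (r + 2) ^ N' * H r j) * linForm (M j) +
      C (Polynomial.X ^ K) * - (z (r + 2) ^ N' * R' r)) =
      - (z 0 * z 1 * z 2) ^ N' * (z r ^ (N + 1) * ρ r a) := by
    intro r
    have h4 : ∑ j, - (z (r + 2) ^ N' * H r j) * linForm (M j) =
        - (z (r + 2) ^ N' * ∑ j, H r j * linForm (M j)) := by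
      rw [Finset.mul_sum, ← Finset.sum_neg_distrib]
      exact Finset.sum_congr rfl fun _ _ => by ring
    have h2 : (z 0 * z 1 * z 2) = z r * z (r + 1) * z (r + 2) := by
      fin_cases r <;> simp <;> ring
    rw [h2, h4]
    linear_combination z r ^ (N + N' + 1) * z (r + 2) ^ N' * (hH r).2
  rw [Finset.sum_congr rfl fun r _ => h1 r, Fin.sum_univ_three]
  have h3 : (C (Polynomial.C ((x 0 * x 1 * x 2) ^ (N + N'))) : MvPolynomial ι (Polynomial B)) =
      (z 0 * z 1 * z 2) ^ (N + N') := by simp [hz]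
  rw [h3, hLb]
  simp only [hρ, if_neg hab, if_true, zero_sub, zero_add, Fin.reduceAdd, Fin.isValue]
  ring

end Zigzag

section DeformationChoice

open Matrix in
theorem exists_deformation {B : Type*} [CommRing B] [IsDomain B] [IsLocalRing B] {x : Fin 3 → B}
    (hx0 : x 0 ≠ 0) (hmax : IsLocalRing.maximalIdeal B = Ideal.span (Set.range x)) {p : ℕ}
    {M : Fin (p + 2) → Fin (p + 3) → B} (hM : ∀ j i, M j i ∈ IsLocalRing.maximalIdeal B) :
    ∃ M' : Fin (p + 2) → Fin (p + 3) → Polynomial B,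
      (∀ j i, Polynomial.constantCoeff (M' j i) = M j i) ∧
      (∃ Na : Fin 3 → Fin (p + 3) → Polynomial B,
        ∀ i, M' (Fin.last _) i = ∑ l, Polynomial.C (x l) * Na l i) ∧
      (∃ Nb : Fin 3 → Fin (p + 3) → Polynomial B,
        ∀ i, M' (Fin.last _).castSucc i = ∑ l, Polynomial.C (x l) * Nb l i) ∧
      ∃ δ ≠ 0, ∃ (g : Fin (p + 3) → Polynomial B) (e : Fin (p + 3)),
        (∀ i : Fin (p + 1), ∑ c, M' i.castSucc c * g c = if i = Fin.last p then δ else 0) ∧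
        ∀ m, (g e ^ m).coeff (p * m) ∉ IsLocalRing.maximalIdeal B := by
  let v : Fin (p + 1) → B := fun i => if i = Fin.last p then x 0 else 1
  let D : Fin (p + 2) → Fin (p + 3) → B := fun j c =>
    Fin.lastCases 0 (fun i => if c = i.castSucc.castSucc then v i else 0) j
  let M' : Fin (p + 2) → Fin (p + 3) → Polynomial B := fun j c =>
    Polynomial.C (M j c) + Polynomial.X * Polynomial.C (D j c)
  have hx0m : x 0 ∈ IsLocalRing.maximalIdeal B := hmax ▸ Ideal.subset_span ⟨0, rfl⟩
  have hrow : ∀ j, (∀ i, D j i ∈ IsLocalRing.maximalIdeal B) →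
      ∃ Na : Fin 3 → Fin (p + 3) → Polynomial B, ∀ i, M' j i = ∑ l, Polynomial.C (x l) * Na l i :=
          by
    intro j hj
    have h1 := fun i => Ideal.mem_span_range_iff_exists_fun.1 (hmax ▸ hM j i)
    have h2 := fun i => Ideal.mem_span_range_iff_exists_fun.1 (hmax ▸ hj i)
    choose a ha using h1
    choose b hb using h2
    refine ⟨fun l i => Polynomial.C (a i l) + Polynomial.X * Polynomial.C (b i l), fun i => ?_⟩
    simp only [M', ← ha, ← hb, map_sum, map_mul, Finset.mul_sum, ← Finset.sum_add_distrib]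
    exact Finset.sum_congr rfl fun _ _ => by ring
  let S : Matrix (Fin (p + 1)) (Fin (p + 1)) (Polynomial B) :=
    Matrix.of fun i k => M' i.castSucc k.castSucc.castSucc
  have hS : S = (Polynomial.X : Polynomial B) • (diagonal v).map Polynomial.C +
      (Matrix.of fun i k : Fin (p + 1) => M i.castSucc k.castSucc.castSucc).map Polynomial.C := by
    ext1 i k
    simp only [S, M', D, Matrix.of_apply, Matrix.add_apply, Matrix.smul_apply, Matrix.map_apply,
      Fin.lastCases_castSucc, smul_eq_mul, diagonal_apply, Fin.castSucc_inj, eq_comm (a := k)]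
    ring
  have hdet : S.det ≠ 0 := by
    intro h
    have h1 := Polynomial.coeff_det_X_add_C_card (diagonal v)
      (Matrix.of fun i k : Fin (p + 1) => M i.castSucc k.castSucc.castSucc)
    rw [← hS, h, Polynomial.coeff_zero, det_diagonal, Finset.prod_ite_eq'] at h1
    simp [hx0.symm] at h1
  refine ⟨M', fun j i => by simp [M'], hrow _ fun i => by simp [D], hrow _ fun i => ?_, S.det, hdet,
    fun c => Fin.lastCases 0 (Fin.lastCases 0 fun k => S.adjugate k (Fin.last p)) c,
    (Fin.last p).castSucc.castSucc, fun i => ?_, fun m => ?_⟩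
  · simp only [D, Fin.lastCases_castSucc, v, if_true]
    split_ifs
    · exact hx0m
    · exact zero_mem _
  · rw [Fin.sum_univ_castSucc, Fin.sum_univ_castSucc]
    have h1 := congrFun (congrFun (mul_adjugate S) i) (Fin.last p)
    simp only [Matrix.mul_apply, Matrix.smul_apply, Matrix.one_apply, smul_eq_mul, mul_ite, mul_one,
      mul_zero] at h1
    simp only [Fin.lastCases_castSucc, Fin.lastCases_last, mul_zero, add_zero]
    exact h1
  · simp only [Fin.lastCases_castSucc]
    let φ := Polynomial.mapRingHom (IsLocalRing.residue B)
    have h1 : φ (S.adjugate (Fin.last p) (Fin.last p)) = Polynomial.X ^ p := by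
      have h2 : φ.mapMatrix S = diagonal fun i => if i = Fin.last p then 0 else Polynomial.X := by
        ext1 i k
        have h0 := (IsLocalRing.residue_eq_zero_iff _).2 hx0m
        have hM0 := fun j i => (IsLocalRing.residue_eq_zero_iff _).2 (hM j i)
        rw [hS]
        simp only [φ, RingHom.mapMatrix_apply, Matrix.map_apply, Matrix.add_apply,
            Matrix.smul_apply,
          diagonal_apply, Matrix.of_apply, smul_eq_mul, map_add,
          Polynomial.coe_mapRingHom, Polynomial.map_C, hM0, v]
        split_ifs <;> simp [h0]
      have h3 := congrFun (congrFun (φ.map_adjugate S) (Fin.last p)) (Fin.last p)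
      rw [h2, adjugate_diagonal, diagonal_apply_eq] at h3
      rw [RingHom.mapMatrix_apply, Matrix.map_apply] at h3
      rw [h3, Finset.prod_congr rfl (g := fun _ => Polynomial.X) (fun j hj => by
        rw [if_neg (Finset.ne_of_mem_erase hj)])]
      simp
    rw [← IsLocalRing.residue_eq_zero_iff, ← Polynomial.coeff_map]
    have h2 : (S.adjugate (Fin.last p) (Fin.last p) ^ m).map (IsLocalRing.residue B) =
        Polynomial.X ^ (p * m) := by
      rw [← Polynomial.coe_mapRingHom, map_pow, h1, pow_mul]
    rw [h2, Polynomial.coeff_X_pow_self]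
    exact one_ne_zero

end DeformationChoice

section TwoGenerators

theorem card_le_two_of_pow_saturated {B : Type*} [CommRing B] [IsDomain B] [IsLocalRing B]
    [IsNoetherianRing B] {x : Fin 3 → B} (hx : IsRegularTriple x)
    (hmax : IsLocalRing.maximalIdeal B = Ideal.span (Set.range x)) {n : ℕ} {f : Fin n → B}
    (hmin : ∀ w : Fin n → B, ∑ i, w i * f i = 0 → ∀ i, w i ∈ IsLocalRing.maximalIdeal B)
    (hsat : ∀ h, (∀ l, x l * h ∈ Ideal.span (Set.range f)) → h ∈ Ideal.span (Set.range f))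
    {m : ℕ} (hsatm : ∀ h, (∀ l, x l * h ∈ Ideal.span (Set.range f) ^ (m + 2)) →
      h ∈ Ideal.span (Set.range f) ^ (m + 2))
    (hinv : ∀ a b : B, (∀ i, b ∣ a * f i) → b ∣ a)
    (hgood : ∀ P : Ideal B, P.IsPrime → P ≠ IsLocalRing.maximalIdeal B →
      ∃ p ∈ Ideal.span (Set.range f), ∃ q ∈ Ideal.span (Set.range f), ∃ s ∉ P,
        ∀ i, s * f i ∈ Ideal.span {p, q}) :
    n ≤ 2 := by
  by_contra! hn
  obtain ⟨p, rfl⟩ : ∃ p, n = p + 3 := ⟨n - 3, by omega⟩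
  have hf0 : ∀ i, f i ≠ 0 := by
    intro i hi
    have h1 := hmin (Pi.single i 1) (by simp [Pi.single_apply, hi]) i
    rw [Pi.single_eq_same] at h1
    exact (IsLocalRing.mem_maximalIdeal 1).1 h1 isUnit_one
  obtain ⟨M, hMm, hM, hspan, hind⟩ :=
    exists_hilbertBurch_matrix (q := p + 2) hx hmax hf0 hmin hsat
  obtain ⟨ε, hε, hminor⟩ := exists_signedMinor_eq (hf0 0) hspan hinv
  obtain ⟨M', hM', ⟨Na, ha⟩, ⟨Nb, hb⟩, δ, hδ, g, e, hg, hge⟩ :=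
      exists_deformation hx.ne_zero hmax hMm
  have hxm : ∀ l, x l ∈ IsLocalRing.maximalIdeal B := fun l => hmax ▸ Ideal.subset_span ⟨l, rfl⟩
  have hexact := fun l => exact_on_punctured hf0 hM hspan hind hinv hgood (hxm l)
  set d : Fin (p + 3) → B := fun i => ε * f i with hd
  have hrees : ∀ l Q, reesHom d Q = 0 → ∃ N : ℕ,
      C (x l ^ N) * Q ∈ Ideal.span (Set.range fun j => linForm (M j)) := fun l Q hQ =>
    (hexact l).1 Q (reesHom_mul_left_eq_zero hε hQ)
  have hd' : ∀ i, Polynomial.constantCoeff (signedMinor M' i) = d i := fun i => by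
    rw [map_signedMinor]
    simp only [hM']
    exact hminor i
  have hMd : ∀ j, ∑ i, M' j i * signedMinor M' i = 0 := sum_row_mul_signedMinor M'
  have hsat' : ∀ r, (∀ l, ∃ N : ℕ, x l ^ N * r ∈ Ideal.span (Set.range d) ^ (m + 2)) →
      r ∈ Ideal.span (Set.range d) ^ (m + 2) := fun r => hx.mem_span_range_mul_pow hε hsatm
  obtain ⟨δ', hδ', hδX⟩ := Polynomial.exists_eq_pow_rootMultiplicity_mul_and_not_dvd δ hδ 0
  rw [map_zero, sub_zero] at hδ' hδX
  set o := Polynomial.rootMultiplicity 0 δ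
  obtain ⟨N, G, R, hGa, hG⟩ := deformation_zigzag (K := o + (p * m + 1)) hx hMd
    (fun l => deformation_rees hM' hd' hMd (hrees l) _)
    (fun l => deformation_koszul hM' (hexact l).2 _)
    (deformation_saturated hM' hd' hMd hrees hsat' _) (Fin.castSucc_ne_last _).symm ha hb e
  have hGg := congrArg (eval g) hG
  have hGr : ∀ r, eval g (∑ j, G r j * linForm (M' j)) = eval g (G r (Fin.last p).castSucc) * δ :=
      by
    intro r
    simp only [map_sum, map_mul, eval_linForm]
    rw [Fin.sum_univ_castSucc, hGa, map_zero, zero_mul, add_zero]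
    simp only [hg, mul_ite, mul_zero, Finset.sum_ite_eq', Finset.mem_univ, if_true]
  rw [map_mul (eval g), map_mul (eval g), map_pow (eval g), eval_C, eval_X, eval_linForm, hg,
    if_pos rfl, map_sum] at hGg
  simp only [map_mul (eval g), map_add (eval g), eval_C, hGr] at hGg
  have hY : Polynomial.X ^ (p * m + 1) ∣ δ' * (Polynomial.C ((x 0 * x 1 * x 2) ^ N) * g e ^ m -
      ∑ r, Polynomial.C (x r ^ (N + 1)) * eval g (G r (Fin.last p).castSucc)) := by
    refine ⟨∑ r, Polynomial.C (x r ^ (N + 1)) * eval g (R r), ?_⟩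
    apply mul_left_cancel₀ (pow_ne_zero o (Polynomial.X_ne_zero (R := B)))
    rw [Fin.sum_univ_three] at hGg ⊢
    rw [Fin.sum_univ_three]
    rw [hδ'] at hGg
    linear_combination hGg
  have hcoeff := Polynomial.X_pow_dvd_iff.1
    (Polynomial.prime_X.pow_dvd_of_dvd_mul_left _ hδX hY) (p * m) (Nat.lt_succ_self _)
  rw [Polynomial.coeff_sub, Polynomial.coeff_C_mul, Polynomial.finsetSum_coeff,
      sub_eq_zero] at hcoeff
  simp only [Polynomial.coeff_C_mul] at hcoeff
  refine hge m (hmax ▸ hx.mem_of_monomial_mem N _ ?_)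
  rw [hcoeff]
  exact Ideal.sum_mem _ fun r _ => Ideal.mul_mem_right _ _ (Ideal.subset_span ⟨r, rfl⟩)

end TwoGenerators

section PointIdeal

variable {k : Type*} [Field k] {v : Fin 3 → k} {c : Fin 3}

/-- The linear form `x_d - (v_d / v_c) x_c` vanishing at `v`. -/
noncomputable def pointForm (v : Fin 3 → k) (c d : Fin 3) : MvPolynomial (Fin 3) k :=
  X d - C (v d / v c) * X c

theorem pointForm_mem (hc : v c ≠ 0) (d : Fin 3) : pointForm v c d ∈ pointIdeal v :=
  Ideal.subset_span ⟨(isHomogeneous_X k d).sub ((isHomogeneous_X k c).C_mul _), by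
    simp [pointForm, hc]⟩

theorem pointForm_self (hc : v c ≠ 0) : pointForm v c c = 0 := by
  simp [pointForm, hc]

/-- Expansion along the ideal of `v`, graded by the order of vanishing. -/
noncomputable def pointExpand (v : Fin 3 → k) (c : Fin 3) :
    MvPolynomial (Fin 3) k →ₐ[k] Polynomial (MvPolynomial (Fin 3) k) :=
  aeval fun d => Polynomial.C (C (v d / v c) * X c) + Polynomial.X * Polynomial.C (pointForm v c d)

theorem eval_one_pointExpand (P : MvPolynomial (Fin 3) k) :
    Polynomial.eval 1 (pointExpand v c P) = P := by
  have h : ((Polynomial.evalRingHom (1 : MvPolynomial (Fin 3) k)).comp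
      (pointExpand v c : _ →+* Polynomial (MvPolynomial (Fin 3) k))) = RingHom.id _ := by
    ext d
    · simp [pointExpand]
    · simp [pointExpand, pointForm]
  exact congrArg (fun φ : MvPolynomial (Fin 3) k →+* MvPolynomial (Fin 3) k => φ P) h

theorem mem_pow_of_X_pow_dvd_pointExpand {J : Ideal (MvPolynomial (Fin 3) k)}
    (hJ : ∀ d, pointForm v c d ∈ J) {m : ℕ} {P : MvPolynomial (Fin 3) k}
    (hP : Polynomial.X ^ m ∣ pointExpand v c P) : P ∈ J ^ m := by
  have h1 : ∀ P, pointExpand v c P ∈ reesAlgebra J := by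
    intro P
    induction P using MvPolynomial.induction_on with
    | C a =>
      rw [pointExpand, algHom_C]
      exact (reesAlgebra J).algebraMap_mem (C a)
    | add P Q hP hQ => rw [map_add]; exact add_mem hP hQ
    | mul_X P d hP =>
      rw [map_mul]
      refine mul_mem hP ?_
      rw [pointExpand, aeval_X]
      refine add_mem ((reesAlgebra J).algebraMap_mem _) ?_
      rw [mul_comm, Polynomial.C_mul_X_eq_monomial]
      exact reesAlgebra.monomial_mem.2 (by simpa using hJ d)
  rw [← eval_one_pointExpand (v := v) (c := c) P, Polynomial.eval_eq_sum, Polynomial.sum]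
  refine Ideal.sum_mem _ fun i _ => ?_
  rw [one_pow, mul_one]
  by_cases hi : i < m
  · rw [Polynomial.X_pow_dvd_iff.1 hP i hi]
    exact zero_mem _
  · exact Ideal.pow_le_pow_right (not_lt.1 hi) ((mem_reesAlgebra_iff _ _).1 (h1 P) i)

theorem exists_eq_linForm_of_isHomogeneous_one {A ι : Type*} [CommRing A] [Fintype ι]
    {f : MvPolynomial ι A} (hf : f.IsHomogeneous 1) : ∃ w, f = linForm w := by
  classical
  have h := (homogeneousSubmodule_one_eq_span_X (σ := ι) (R := A)) ▸
    (mem_homogeneousSubmodule 1 f).2 hf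
  obtain ⟨w, hw⟩ := (Submodule.mem_span_range_iff_exists_fun A).1 h
  exact ⟨w, by rw [← hw, linForm]; simp [smul_eq_C_mul]⟩

theorem X_pow_dvd_pointExpand {m : ℕ} {P : MvPolynomial (Fin 3) k}
    (hP : P ∈ pointIdeal v ^ m) : Polynomial.X ^ m ∣ pointExpand v c P := by
  have h1 : (pointIdeal v).map (pointExpand v c) ≤ Ideal.span {Polynomial.X} := by
    rw [pointIdeal, Ideal.map_span, Ideal.span_le]
    rintro _ ⟨f, ⟨hf, hfv⟩, rfl⟩
    obtain ⟨w, rfl⟩ := exists_eq_linForm_of_isHomogeneous_one hf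
    rw [eval_linForm] at hfv
    rw [SetLike.mem_coe, Ideal.mem_span_singleton]
    have h2 : ∑ d, w d * (v d / v c) = 0 := by
      simp_rw [← mul_div_assoc, ← Finset.sum_div, hfv, zero_div]
    refine ⟨∑ d, Polynomial.C (C (w d) * pointForm v c d), ?_⟩
    have h3 : pointExpand v c (linForm w) = Polynomial.C (C (∑ d, w d * (v d / v c)) * X c) +
        Polynomial.X * ∑ d, Polynomial.C (C (w d) * pointForm v c d) := by
      simp only [linForm, map_sum, map_mul, Finset.sum_mul, Finset.mul_sum,
          ← Finset.sum_add_distrib]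
      refine Finset.sum_congr rfl fun d _ => ?_
      rw [pointExpand, algHom_C, aeval_X, IsScalarTower.algebraMap_apply k (MvPolynomial (Fin 3) k),
        Polynomial.algebraMap_eq, algebraMap_eq, map_mul]
      ring
    rw [h3, h2]
    simp
  have h2 := Ideal.mem_map_of_mem (pointExpand v c) hP
  rw [Ideal.map_pow] at h2
  have h3 := Ideal.pow_right_mono h1 m h2
  rwa [Ideal.span_singleton_pow, Ideal.mem_span_singleton] at h3

theorem mem_pointIdeal_pow_iff (hc : v c ≠ 0) {m : ℕ} {P : MvPolynomial (Fin 3) k} :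
    P ∈ pointIdeal v ^ m ↔ Polynomial.X ^ m ∣ pointExpand v c P :=
  ⟨X_pow_dvd_pointExpand, mem_pow_of_X_pow_dvd_pointExpand (pointForm_mem hc)⟩

theorem eval_eq_zero_of_mem_pointIdeal {P : MvPolynomial (Fin 3) k} (hP : P ∈ pointIdeal v) :
    eval v P = 0 := by
  have : pointIdeal v ≤ RingHom.ker (eval v) := Ideal.span_le.2 fun f hf => hf.2
  exact this hP

theorem mem_pointIdeal_pow_of_mul_mem (hv : v ≠ 0) {m : ℕ} {s P : MvPolynomial (Fin 3) k}
    (hs : s ∉ pointIdeal v) (h : s * P ∈ pointIdeal v ^ m) : P ∈ pointIdeal v ^ m := by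
  obtain ⟨c, hc⟩ := Function.ne_iff.1 hv
  rw [← pow_one (pointIdeal v), mem_pointIdeal_pow_iff hc, pow_one] at hs
  rw [mem_pointIdeal_pow_iff hc, map_mul] at h
  exact (mem_pointIdeal_pow_iff hc).2 (Polynomial.prime_X.pow_dvd_of_dvd_mul_left _ hs h)

theorem isPrime_pointIdeal (hv : v ≠ 0) : (pointIdeal v).IsPrime where
  ne_top' := by
    rw [Ideal.ne_top_iff_one]
    intro h
    simpa using eval_eq_zero_of_mem_pointIdeal h
  mem_or_mem' := by
    intro P Q h
    by_contra! hPQ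
    exact hPQ.2 (by simpa using mem_pointIdeal_pow_of_mul_mem (m := 1) hv hPQ.1 (by simpa using h))

theorem exists_X_notMem_pointIdeal (hv : v ≠ 0) : ∃ c : Fin 3, X c ∉ pointIdeal v := by
  obtain ⟨c, hc⟩ := Function.ne_iff.1 hv
  exact ⟨c, fun h => hc (by simpa using eval_eq_zero_of_mem_pointIdeal h)⟩

theorem pointIdeal_eq_span_pair (hc : v c ≠ 0) :
    pointIdeal v = Ideal.span {pointForm v c (c + 1), pointForm v c (c + 2)} := by
  apply le_antisymm
  · intro P hP
    rw [← pow_one (Ideal.span _)]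
    refine mem_pow_of_X_pow_dvd_pointExpand (v := v) (c := c) (fun d => ?_)
      (X_pow_dvd_pointExpand (by rwa [pow_one]))
    have hd : ∀ c d : Fin 3, d = c ∨ d = c + 1 ∨ d = c + 2 := by decide
    rcases hd c d with rfl | rfl | rfl
    · rw [pointForm_self hc]
      exact zero_mem _
    · exact Ideal.subset_span (by simp)
    · exact Ideal.subset_span (by simp)
  · rw [Ideal.span_le]
    rintro _ (rfl | rfl) <;> exact pointForm_mem hc _

theorem X_mem_of_pointIdeal_le {w : Fin 3 → k} (hvw : LinearIndependent k ![v, w])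
    {J : Ideal (MvPolynomial (Fin 3) k)} (hv : pointIdeal v ≤ J) (hw : pointIdeal w ≤ J)
    (l : Fin 3) : X l ∈ J := by
  obtain ⟨c, hc⟩ := Function.ne_iff.1 (hvw.ne_zero 0)
  obtain ⟨e, he⟩ := Function.ne_iff.1 (hvw.ne_zero 1)
  simp only [Matrix.cons_val_zero, Matrix.cons_val_one, Pi.zero_apply] at hc he
  have hX : ∀ d, X d - C (v d / v c) * X c ∈ J := fun d => hv (pointForm_mem hc d)
  obtain ⟨d, hd⟩ : ∃ d, w e * v d ≠ w d * v e := by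
    by_contra! h
    have := LinearIndependent.pair_iff.1 hvw (w e) (- v e) (by
      ext d
      simp only [Pi.add_apply, Pi.smul_apply, smul_eq_mul, Pi.zero_apply]
      linear_combination h d)
    exact he this.1
  have h1 : X d - C (w d / w e) * X e ∈ J := hw (pointForm_mem he d)
  have h2 : C (v d / v c - w d / w e * (v e / v c)) * X c ∈ J := by
    have : C (v d / v c - w d / w e * (v e / v c)) * X c =
        (X d - C (w d / w e) * X e) - (X d - C (v d / v c) * X c) +
        C (w d / w e) * (X e - C (v e / v c) * X c) := by
      simp only [map_sub, map_mul]
      ring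
    rw [this]
    exact add_mem (sub_mem h1 (hX d)) (Ideal.mul_mem_left _ _ (hX e))
  have h3 : v d / v c - w d / w e * (v e / v c) ≠ 0 := by
    intro h
    field_simp at h
    exact hd (by linear_combination h)
  have h4 : X c ∈ J := (Ideal.unit_mul_mem_iff_mem J ((isUnit_iff_ne_zero.2 h3).map C)).1 h2
  have h5 := add_mem (hX l) (Ideal.mul_mem_left J (C (v l / v c)) h4)
  rwa [sub_add_cancel] at h5

end PointIdeal

section Transfer

variable {A : Type*} [CommRing A]

theorem mem_map_of_forall_mul_mem_map {B : Type*} [CommRing B] [Algebra A B] (M : Submonoid A)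
    [IsLocalization M B] {ι : Type*} [Fintype ι] {J K : Ideal A} {x : ι → A}
    (h : ∀ u, (∀ l, x l * u ∈ J) → u ∈ K) {u : B}
    (hu : ∀ l, algebraMap A B (x l) * u ∈ J.map (algebraMap A B)) :
    u ∈ K.map (algebraMap A B) := by
  classical
  obtain ⟨u, t, rfl⟩ := IsLocalization.exists_mk'_eq M u
  have h1 : ∀ l, ∃ r ∈ M, r * (x l * u) ∈ J := by
    intro l
    refine (IsLocalization.algebraMap_mem_map_algebraMap_iff M B J _).1 ?_
    have := Ideal.mul_mem_right (algebraMap A B t) _ (hu l)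
    rwa [mul_assoc, IsLocalization.mk'_spec, ← map_mul] at this
  choose r hr hrJ using h1
  have h2 : (∏ l, r l) * u ∈ K := by
    refine h _ fun l => ?_
    obtain ⟨e, he⟩ := Finset.dvd_prod_of_mem r (Finset.mem_univ l)
    rw [he]
    have := Ideal.mul_mem_left J e (hrJ l)
    convert this using 1
    ring
  rw [IsLocalization.mk'_mem_map_algebraMap_iff M B]
  exact ⟨∏ l, r l, prod_mem fun l _ => hr l, h2⟩

theorem algebraMap_dvd_of_dvd_mul {B : Type*} [CommRing B] [Algebra A B] (M : Submonoid A)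
    [IsLocalization M B] {a b : A} (h : ∀ u, a ∣ u * b → a ∣ u) {u : B}
    (hu : algebraMap A B a ∣ u * algebraMap A B b) : algebraMap A B a ∣ u := by
  have := mem_map_of_forall_mul_mem_map (B := B) M (ι := Unit) (J := Ideal.span {a})
    (K := Ideal.span {a}) (x := fun _ => b) (fun w hw => by
      have := hw ()
      rw [Ideal.mem_span_singleton, mul_comm] at this
      exact Ideal.mem_span_singleton.2 (h w this)) (u := u)
    (fun _ => by rwa [Ideal.map_span, Set.image_singleton, mul_comm, Ideal.mem_span_singleton])
  rwa [Ideal.map_span, Set.image_singleton, Ideal.mem_span_singleton] at this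

theorem dvd_of_forall_mem_of_pair [IsDomain A] {J : Ideal A} {p q : A} (hp : p ∈ J) (hq : q ∈ J)
    (hp0 : p ≠ 0) (hpq : ∀ u, p ∣ u * q → p ∣ u) {a b : A} (h : ∀ g ∈ J, b ∣ a * g) : b ∣ a := by
  obtain ⟨e, he⟩ := h p hp
  obtain ⟨e', he'⟩ := h q hq
  rcases eq_or_ne b 0 with rfl | hb
  · rw [zero_mul] at he
    exact ((mul_eq_zero.1 he).resolve_right hp0) ▸ dvd_rfl
  · obtain ⟨w, rfl⟩ := hpq e ⟨e', mul_left_cancel₀ hb (by linear_combination p * he' - q * he)⟩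
    exact ⟨w, mul_right_cancel₀ hp0 (by linear_combination he)⟩

theorem dvd_of_forall_mem_prod {ι : Type*} (s : Finset ι) (J : ι → Ideal A)
    (hJ : ∀ i ∈ s, ∀ a b, (∀ g ∈ J i, b ∣ a * g) → b ∣ a) (a b : A)
    (h : ∀ g ∈ ∏ i ∈ s, J i, b ∣ a * g) : b ∣ a := by
  classical
  induction s using Finset.induction_on generalizing a with
  | empty => simpa using h 1 (by simp)
  | insert i s hi ih =>
    rw [Finset.prod_insert hi] at h
    refine hJ i (Finset.mem_insert_self i s) a b fun g hg => ?_
    refine ih (fun j hj => hJ j (Finset.mem_insert_of_mem hj)) (a * g) fun g' hg' => ?_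
    rw [mul_assoc]
    exact h _ (Ideal.mul_mem_mul hg hg')

end Transfer

section Points

variable {k : Type*} [Field k]

theorem sub_mem_of_forall_X {σ : Type*} {J : Ideal (MvPolynomial σ k)}
    (χ : MvPolynomial σ k →ₐ[k] MvPolynomial σ k) (hX : ∀ i, X i - χ (X i) ∈ J)
    (P : MvPolynomial σ k) : P - χ P ∈ J := by
  have h : Ideal.Quotient.mkₐ k J = (Ideal.Quotient.mkₐ k J).comp χ := by
    ext i
    exact Ideal.Quotient.eq.2 (hX i)
  exact Ideal.Quotient.eq.1 (DFunLike.congr_fun h P)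

theorem dvd_of_dvd_mul_of_algHom {σ : Type*} {a b : MvPolynomial σ k}
    (χ : MvPolynomial σ k →ₐ[k] MvPolynomial σ k) (hX : ∀ i, a ∣ X i - χ (X i)) (ha : χ a = 0)
    (hb : χ b ≠ 0) {u : MvPolynomial σ k} (h : a ∣ u * b) : a ∣ u := by
  have h1 : χ u = 0 := by
    have := map_dvd χ h
    rw [ha, zero_dvd_iff, map_mul] at this
    exact (mul_eq_zero.1 this).resolve_right hb
  have h2 := sub_mem_of_forall_X (J := Ideal.span {a}) χ
    (fun i => Ideal.mem_span_singleton.2 (hX i)) u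
  rwa [h1, sub_zero, Ideal.mem_span_singleton] at h2

theorem pointForm_ne_zero {v : Fin 3 → k} {c d : Fin 3} (hcd : d ≠ c) : pointForm v c d ≠ 0 := by
  intro h
  have := congrArg (eval (Pi.single d 1)) h
  simp [pointForm, hcd.symm] at this

theorem pointForm_dvd_of_dvd_mul {v : Fin 3 → k} {c d e : Fin 3} (hd : d ≠ c) (he : e ≠ c)
    (hde : e ≠ d) {u : MvPolynomial (Fin 3) k} (h : pointForm v c d ∣ u * pointForm v c e) :
    pointForm v c d ∣ u := by
  let χ : MvPolynomial (Fin 3) k →ₐ[k] MvPolynomial (Fin 3) k :=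
    aeval (Function.update X d (C (v d / v c) * X c))
  have hc : χ (X c) = X c := by simp [χ, hd.symm]
  refine dvd_of_dvd_mul_of_algHom χ (fun i => ?_) ?_ ?_ h
  · rcases eq_or_ne i d with rfl | hi
    · simp [χ, pointForm]
    · simp [χ, hi]
  · rw [pointForm, map_sub, map_mul, hc, algHom_C]
    simp [χ]
  · have : χ (pointForm v c e) = pointForm v c e := by
      rw [pointForm, map_sub, map_mul, hc, algHom_C]
      simp [χ, hde]
    rw [this]
    exact pointForm_ne_zero he

variable {s : ℕ} {v : Fin s → Fin 3 → k}

theorem mem_pointsSymb_of_forall_X_mul_mem (hv0 : ∀ i, v i ≠ 0) {m : ℕ}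
    {h : MvPolynomial (Fin 3) k} (hh : ∀ l, X l * h ∈ pointsSymb v m) : h ∈ pointsSymb v m := by
  refine Ideal.mem_iInf.2 fun i => ?_
  obtain ⟨l, hl⟩ := exists_X_notMem_pointIdeal (hv0 i)
  exact mem_pointIdeal_pow_of_mul_mem (hv0 i) hl (Ideal.mem_iInf.1 (hh l) i)

theorem pointsSymb_one : pointsSymb v 1 = pointsIdeal v := by
  simp [pointsSymb, pointsIdeal]

theorem prod_pointIdeal_le : ∏ i, pointIdeal (v i) ≤ pointsIdeal v :=
  le_iInf fun i => Ideal.prod_le_inf.trans (Finset.inf_le (Finset.mem_univ i))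

theorem dvd_of_forall_mem_map_pointsIdeal {B : Type*} [CommRing B] [IsDomain B]
    [Algebra (MvPolynomial (Fin 3) k) B] (M : Submonoid (MvPolynomial (Fin 3) k))
    [IsLocalization M B] (hM : M ≤ nonZeroDivisors _) (hv0 : ∀ i, v i ≠ 0) {a b : B}
    (h : ∀ f ∈ pointsIdeal v, b ∣ a * algebraMap _ B f) : b ∣ a := by
  set φ := algebraMap (MvPolynomial (Fin 3) k) B
  have hφ : Function.Injective φ := IsLocalization.injective B hM
  refine dvd_of_forall_mem_prod Finset.univ (fun i => (pointIdeal (v i)).map φ) ?_ a b ?_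
  · intro i _ a b hab
    obtain ⟨c, hc⟩ := Function.ne_iff.1 (hv0 i)
    have hfin : ∀ c : Fin 3, c + 1 ≠ c ∧ c + 2 ≠ c ∧ c + 2 ≠ c + 1 := by decide
    refine dvd_of_forall_mem_of_pair
      (Ideal.mem_map_of_mem φ (pointForm_mem hc (c + 1)))
      (Ideal.mem_map_of_mem φ (pointForm_mem hc (c + 2)))
      ((map_ne_zero_iff φ hφ).2 (pointForm_ne_zero (hfin c).1)) (fun u hu => ?_) hab
    exact algebraMap_dvd_of_dvd_mul M
      (fun w => pointForm_dvd_of_dvd_mul (hfin c).1 (hfin c).2.1 (hfin c).2.2) hu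
  · intro g hg
    have h1 : ∏ i, (pointIdeal (v i)).map φ ≤ (pointsIdeal v).map φ := by
      have := Ideal.map_mono (f := φ) (prod_pointIdeal_le (v := v))
      rwa [← Ideal.mapHom_apply, map_prod] at this
    have h2 : (pointsIdeal v).map φ ≤
        Submodule.comap (LinearMap.mulLeft B a) (Ideal.span {b}) := by
      refine Ideal.span_le.2 ?_
      rintro _ ⟨f, hf, rfl⟩
      exact Ideal.mem_span_singleton.2 (h f hf)
    exact Ideal.mem_span_singleton.1 (h2 (h1 hg))

theorem exists_notMem_forall_mul_mem_pointsIdeal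
    (hvind : ∀ i j, i ≠ j → LinearIndependent k ![v i, v j])
    {P : Ideal (MvPolynomial (Fin 3) k)} (hP : P.IsPrime) {l : Fin 3} (hl : X l ∉ P) {i : Fin s}
    (hi : pointIdeal (v i) ≤ P) : ∃ t ∉ P, ∀ g ∈ pointIdeal (v i), t * g ∈ pointsIdeal v := by
  classical
  have h1 : ∀ j, ∃ t, t ∉ P ∧ (j ≠ i → t ∈ pointIdeal (v j)) := by
    intro j
    by_cases hj : j = i
    · exact ⟨1, fun h => hP.ne_top ((Ideal.eq_top_iff_one P).2 h), fun h => absurd hj h⟩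
    · have : ¬ pointIdeal (v j) ≤ P := fun h =>
        hl (X_mem_of_pointIdeal_le (hvind j i hj) h hi l)
      obtain ⟨t, ht, htP⟩ := Set.not_subset.1 this
      exact ⟨t, htP, fun _ => ht⟩
  choose t htP ht using h1
  refine ⟨∏ j, t j, fun h => ?_, fun g hg => Ideal.mem_iInf.2 fun j => ?_⟩
  · obtain ⟨j, -, hj⟩ := hP.prod_mem_iff.1 h
    exact htP j hj
  · rcases eq_or_ne j i with rfl | hj
    · exact Ideal.mul_mem_left _ _ hg
    · exact Ideal.mul_mem_right _ _ (Ideal.mem_of_dvd _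
        (Finset.dvd_prod_of_mem t (Finset.mem_univ j)) (ht j hj))

theorem exists_pair_of_isPrime (hvind : ∀ i j, i ≠ j → LinearIndependent k ![v i, v j])
    (hv0 : ∀ i, v i ≠ 0) {P : Ideal (MvPolynomial (Fin 3) k)} (hP : P.IsPrime) {l : Fin 3}
    (hl : X l ∉ P) : ∃ p ∈ pointsIdeal v, ∃ q ∈ pointsIdeal v, ∃ t ∉ P,
      ∀ f ∈ pointsIdeal v, t * f ∈ Ideal.span {p, q} := by
  by_cases hI : pointsIdeal v ≤ P
  · obtain ⟨i, -, hi⟩ := hP.prod_le.1 (prod_pointIdeal_le.trans hI)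
    obtain ⟨t, htP, ht⟩ := exists_notMem_forall_mul_mem_pointsIdeal hvind hP hl hi
    obtain ⟨c, hc⟩ := Function.ne_iff.1 (hv0 i)
    refine ⟨_, ht _ (pointForm_mem hc (c + 1)), _, ht _ (pointForm_mem hc (c + 2)), t, htP,
      fun f hf => ?_⟩
    have := Ideal.mem_iInf.1 hf i
    rw [pointIdeal_eq_span_pair hc, Ideal.mem_span_pair] at this
    obtain ⟨a, b, rfl⟩ := this
    exact Ideal.mem_span_pair.2 ⟨a, b, by ring⟩
  · obtain ⟨h, hh, hhP⟩ := Set.not_subset.1 hI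
    exact ⟨h, hh, 0, zero_mem _, h, hhP, fun f _ =>
      Ideal.mul_mem_right _ _ (Ideal.subset_span (by simp))⟩

end Points

section PowerCoeff

variable {A ι : Type*} [CommRing A]

theorem exists_isHomogeneous_of_mem_mul_pow {x : ι → A} {J : Ideal A} {m : ℕ} {z : A}
    (hz : z ∈ J * Ideal.span (Set.range x) ^ m) : ∃ F : MvPolynomial ι A,
      F.IsHomogeneous m ∧ eval x F = z ∧ ∀ d, F.coeff d ∈ J := by
  induction hz using Submodule.mul_induction_on' with
  | mem_mul_mem r hr y hy =>
    obtain ⟨F, hF, rfl⟩ := (Ideal.mem_span_pow_iff_exists_isHomogeneous x y).1 hy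
    exact ⟨C r * F, hF.C_mul r, by simp, fun d => by
      rw [coeff_C_mul]; exact Ideal.mul_mem_right _ _ hr⟩
  | add y _ z _ hy hz =>
    obtain ⟨F, hF, rfl, hFJ⟩ := hy
    obtain ⟨G, hG, rfl, hGJ⟩ := hz
    exact ⟨F + G, hF.add hG, map_add _ _ _, fun d => add_mem (hFJ d) (hGJ d)⟩

theorem eval_mem_mul_pow {x : ι → A} {J : Ideal A} {m : ℕ} {F : MvPolynomial ι A}
    (hF : F.IsHomogeneous m) (hJ : ∀ d, F.coeff d ∈ J) :
    eval x F ∈ J * Ideal.span (Set.range x) ^ m := by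
  rw [F.as_sum, map_sum]
  refine Ideal.sum_mem _ fun d hd => ?_
  have h : monomial d (F.coeff d) = C (F.coeff d) * monomial d 1 := by rw [C_mul_monomial, mul_one]
  rw [h, map_mul, eval_C]
  refine Ideal.mul_mem_mul (hJ d) ((Ideal.mem_span_pow_iff_exists_isHomogeneous x _).2
    ⟨_, isHomogeneous_monomial 1 ?_, rfl⟩)
  rw [Finsupp.degree_eq_weight_one]
  exact hF (mem_support_iff.1 hd)

end PowerCoeff

section Points

variable {k : Type*} [Field k] {s : ℕ} {v : Fin s → Fin 3 → k}

theorem pointsIdeal_pow_le_pointsSymb (m : ℕ) : pointsIdeal v ^ m ≤ pointsSymb v m :=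
  le_iInf fun i => Ideal.pow_right_mono (iInf_le _ i) m

theorem dvd_of_forall_mem_pointsIdeal (hv0 : ∀ i, v i ≠ 0) {a b : MvPolynomial (Fin 3) k}
    (h : ∀ f ∈ pointsIdeal v, b ∣ a * f) : b ∣ a :=
  haveI : IsLocalization (⊥ : Submonoid (MvPolynomial (Fin 3) k)) (MvPolynomial (Fin 3) k) :=
    IsLocalization.self bot_le
  dvd_of_forall_mem_map_pointsIdeal ⊥ bot_le hv0 h

theorem pointsSymb_le_pow_of_eq_span_pair (hv0 : ∀ i, v i ≠ 0)
    (hvind : ∀ i j, i ≠ j → LinearIndependent k ![v i, v j]) {f g : MvPolynomial (Fin 3) k}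
    (hf : f ≠ 0) (h : pointsIdeal v = Ideal.span {f, g}) (m : ℕ) :
    pointsSymb v m ≤ pointsIdeal v ^ m := by
  have hr : pointsIdeal v = Ideal.span (Set.range ![f, g]) := by
    rw [h, Matrix.range_cons, Matrix.range_cons, Matrix.range_empty, Set.union_empty]; rfl
  have hfI : f ∈ pointsIdeal v := h ▸ Ideal.subset_span (by simp)
  have hgI : g ∈ pointsIdeal v := h ▸ Ideal.subset_span (by simp)
  have hK : ∀ u, f ∣ u * g → f ∣ u := by
    intro u hu
    refine dvd_of_forall_mem_pointsIdeal hv0 fun p hp => ?_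
    rw [h, Ideal.mem_span_pair] at hp
    obtain ⟨a, b, rfl⟩ := hp
    rw [mul_add]
    exact dvd_add ⟨u * a, by ring⟩ (by
      rw [show u * (b * g) = b * (u * g) by ring]; exact hu.mul_left b)
  induction m with
  | zero => simp
  | succ m ih =>
    intro P hP
    have hPm : P ∈ pointsIdeal v ^ m := ih (Ideal.mem_iInf.2 fun i =>
      Ideal.pow_le_pow_right m.le_succ (Ideal.mem_iInf.1 hP i))
    rw [hr] at hPm
    obtain ⟨F, hF, rfl⟩ := (Ideal.mem_span_pow_iff_exists_isHomogeneous _ P).1 hPm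
    rw [pow_succ']
    nth_rw 2 [hr]
    refine eval_mem_mul_pow hF fun d => Ideal.mem_iInf.2 fun i => ?_
    have hprime := isPrime_pointIdeal (hv0 i)
    obtain ⟨l, hl⟩ := exists_X_notMem_pointIdeal (hv0 i)
    obtain ⟨t, htP, ht⟩ := exists_notMem_forall_mul_mem_pointsIdeal hvind hprime hl le_rfl
    have h1 : t ^ (m + 1) * eval ![f, g] F ∈ pointsIdeal v * Ideal.span (Set.range ![f, g]) ^ m :=
        by
      rw [← hr, ← pow_succ']
      have h2 : Ideal.span {t} * pointIdeal (v i) ≤ pointsIdeal v :=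
        Ideal.span_singleton_mul_le_iff.2 ht
      have h3 := Ideal.pow_right_mono h2 (m + 1)
      rw [mul_pow, Ideal.span_singleton_pow] at h3
      exact h3 (Ideal.mul_mem_mul (Ideal.mem_span_singleton_self _) (Ideal.mem_iInf.1 hP i))
    obtain ⟨G, hG, hGe, hGI⟩ := exists_isHomogeneous_of_mem_mul_pow h1
    have h4 : reesHom ![f, g] (C (t ^ (m + 1)) * F - G) = 0 := by
      rw [reesHom_of_isHomogeneous _ ((hF.C_mul _).sub hG), map_sub, map_mul, eval_C, hGe, sub_self]
      simp
    obtain ⟨E, hE⟩ := dvd_of_reesHom_pair_eq_zero hf hK h4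
    have h5 : C (t ^ (m + 1)) * F - G ∈ (pointsIdeal v).map C := by
      rw [hE]
      exact Ideal.mul_mem_right _ _ (sub_mem
        (Ideal.mul_mem_right _ _ (Ideal.mem_map_of_mem C hgI))
        (Ideal.mul_mem_right _ _ (Ideal.mem_map_of_mem C hfI)))
    have h6 := add_mem (mem_map_C_iff.1 h5 d) (hGI d)
    rw [coeff_sub, sub_add_cancel, coeff_C_mul] at h6
    exact (hprime.mem_or_mem (Ideal.mem_iInf.1 h6 i)).resolve_left
      fun h => htP (hprime.mem_of_pow_mem _ h)

theorem pointsIdeal_pow_eq_of_eq_span_pair (hv0 : ∀ i, v i ≠ 0)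
    (hvind : ∀ i j, i ≠ j → LinearIndependent k ![v i, v j]) {f g : MvPolynomial (Fin 3) k}
    (h : pointsIdeal v = Ideal.span {f, g}) (m : ℕ) : pointsIdeal v ^ m = pointsSymb v m := by
  refine le_antisymm (pointsIdeal_pow_le_pointsSymb m) ?_
  rcases eq_or_ne f 0 with rfl | hf
  · rcases eq_or_ne g 0 with rfl | hg
    · have h0 : (0 : MvPolynomial (Fin 3) k) ∣ 1 :=
        dvd_of_forall_mem_pointsIdeal hv0 fun p hp => by
          simp only [h, Set.pair_eq_singleton, Ideal.mem_span_singleton, zero_dvd_iff] at hp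
          simp [hp]
      exact absurd (zero_dvd_iff.1 h0) one_ne_zero
    · exact pointsSymb_le_pow_of_eq_span_pair hv0 hvind hg (by rw [h, Set.pair_comm]) m
  · exact pointsSymb_le_pow_of_eq_span_pair hv0 hvind hf h m

end Points

attribute [local instance] MvPolynomial.gradedAlgebra

section Homogeneous

variable {k : Type*} [Field k] {σ : Type*}

theorem mem_of_isHomogeneous_of_mul_mem {J : Ideal (MvPolynomial σ k)}
    (hJ : J.IsHomogeneous (homogeneousSubmodule σ k)) {t h : MvPolynomial σ k} {d : ℕ}
    (hh : h.IsHomogeneous d) (ht : constantCoeff t ≠ 0) (hth : t * h ∈ J) : h ∈ J := by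
  classical
  have h1 := hJ d hth
  rw [DirectSum.coe_decompose_mul_of_right_mem_of_le (homogeneousSubmodule σ k)
    ((mem_homogeneousSubmodule d h).2 hh) le_rfl, Nat.sub_self] at h1
  have h2 : (DirectSum.decompose (homogeneousSubmodule σ k) t 0 : MvPolynomial σ k) =
      C (constantCoeff t) :=
    (decomposition.decompose'_apply t 0).trans (homogeneousComponent_zero t)
  rw [h2] at h1
  exact (Ideal.unit_mul_mem_iff_mem J ((isUnit_iff_ne_zero.2 ht).map C)).1 h1

theorem eq_span_isHomogeneous {J : Ideal (MvPolynomial σ k)}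
    (hJ : J.IsHomogeneous (homogeneousSubmodule σ k)) :
    Ideal.span {f | f ∈ J ∧ ∃ d, f.IsHomogeneous d} = J := by
  apply le_antisymm (Ideal.span_le.2 fun f hf => hf.1)
  intro P hP
  rw [← sum_homogeneousComponent P]
  exact Ideal.sum_mem _ fun d _ => Ideal.subset_span
    ⟨homogeneousComponent_mem_of_mem hJ hP d, d, homogeneousComponent_isHomogeneous d P⟩

theorem isHomogeneous_pointsIdeal {s : ℕ} (v : Fin s → Fin 3 → k) :
    (pointsIdeal v).IsHomogeneous (homogeneousSubmodule (Fin 3) k) :=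
  Ideal.IsHomogeneous.iInf fun _ => Ideal.homogeneous_span _ _ fun _ hf => ⟨1, hf.1⟩

end Homogeneous

section RegularTriple

variable {k : Type*} [Field k]

theorem ker_constantCoeff_eq_span (σ : Type*) :
    RingHom.ker (constantCoeff (σ := σ) (R := k)) = Ideal.span (Set.range X) := by
  apply le_antisymm
  · intro P hP
    have := sub_mem_of_forall_X (J := Ideal.span (Set.range X)) (aeval (0 : σ → MvPolynomial σ k))
      (fun i => by simpa using Ideal.subset_span (Set.mem_range_self i)) P
    rwa [aeval_zero, (RingHom.mem_ker).1 hP, map_zero, sub_zero] at this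
  · rw [Ideal.span_le]
    rintro _ ⟨i, rfl⟩
    exact constantCoeff_X k i

theorem mem_span_X_of_X_mul_mem {u : MvPolynomial (Fin 3) k}
    (hu : X 2 * u ∈ Ideal.span {X 0, X 1}) : u ∈ Ideal.span {X 0, X 1} := by
  let χ : MvPolynomial (Fin 3) k →ₐ[k] MvPolynomial (Fin 3) k := aeval ![0, 0, X 2]
  have h1 : Ideal.span {X 0, X 1} ≤ RingHom.ker χ := by
    rw [Ideal.span_le]
    rintro _ (rfl | rfl) <;> simp [χ]
  have h2 : χ u = 0 := by
    have := (RingHom.mem_ker).1 (h1 hu)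
    rw [map_mul] at this
    refine (mul_eq_zero.1 this).resolve_left ?_
    simp [χ]
  have h3 := sub_mem_of_forall_X (J := Ideal.span {X 0, X 1}) χ (fun i => by
    fin_cases i
    · simpa [χ] using Ideal.subset_span (by simp)
    · simpa [χ] using Ideal.subset_span (by simp)
    · simp [χ]) u
  rwa [h2, sub_zero] at h3

theorem mem_span_X_of_monomial_mul_mem {N : ℕ} {u : MvPolynomial (Fin 3) k}
    (hu : (X 0 * X 1 * X 2) ^ N * u ∈ Ideal.span (Set.range fun l => X l ^ (N + 1))) :
    u ∈ Ideal.span (Set.range X) := by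
  set e : Fin 3 →₀ ℕ := Finsupp.equivFunOnFinite.symm fun _ => N with he
  have h1 : ∀ P ∈ Ideal.span (Set.range fun l : Fin 3 => (X l : MvPolynomial (Fin 3) k) ^ (N + 1)),
      coeff e P = 0 := by
    intro P hP
    obtain ⟨w, rfl⟩ := (Submodule.mem_span_range_iff_exists_fun _).1 hP
    rw [coeff_sum]
    refine Finset.sum_eq_zero fun l _ => ?_
    rw [smul_eq_mul, X_pow_eq_monomial, coeff_mul_monomial', if_neg]
    intro h
    have := h l
    simp [he] at this
  have h2 : ((X 0 * X 1 * X 2) ^ N : MvPolynomial (Fin 3) k) = monomial e 1 := by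
    rw [monomial_eq, Finsupp.prod_fintype _ _ (by simp), Fin.prod_univ_three]
    simp [he, mul_pow]
  have h3 := h1 _ hu
  rw [h2, coeff_monomial_mul', if_pos le_rfl, tsub_self, one_mul] at h3
  rw [← ker_constantCoeff_eq_span]
  exact h3

theorem isRegularTriple_algebraMap_X {B : Type*} [CommRing B] [Algebra (MvPolynomial (Fin 3) k) B]
    (M : Submonoid (MvPolynomial (Fin 3) k)) [IsLocalization M B] (hM : M ≤ nonZeroDivisors _) :
    IsRegularTriple fun l : Fin 3 => algebraMap (MvPolynomial (Fin 3) k) B (X l) where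
  ne_zero := (map_ne_zero_iff _ (IsLocalization.injective B hM)).2 (X_ne_zero 0)
  dvd_of_dvd_mul u hu := by
    refine algebraMap_dvd_of_dvd_mul M (fun w => ?_) hu
    refine dvd_of_dvd_mul_of_algHom (aeval (Function.update X 0 0)) (fun i => ?_) ?_ ?_
    · rcases eq_or_ne i 0 with rfl | hi
      · simp
      · simp [hi]
    · simp
    · simp
  mem_of_mul_mem u hu := by
    have := mem_map_of_forall_mul_mem_map (B := B) M (ι := Unit) (x := fun _ => X 2)
      (fun w hw => mem_span_X_of_X_mul_mem (k := k) (hw ())) (u := u)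
    rw [Ideal.map_span, Set.image_pair] at this
    exact this fun _ => hu
  mem_of_monomial_mem N u hu := by
    have := mem_map_of_forall_mul_mem_map (B := B) M (ι := Unit)
      (x := fun _ => (X 0 * X 1 * X 2) ^ N)
      (fun w hw => mem_span_X_of_monomial_mul_mem (k := k) (hw ())) (u := u)
    rw [Ideal.map_span, Ideal.map_span, ← Set.range_comp, ← Set.range_comp] at this
    refine this fun _ => ?_
    simpa [Function.comp_def] using hu

end RegularTriple

section Converse

variable {k : Type*} [Field k] {s : ℕ} {v : Fin s → Fin 3 → k}

theorem exists_eq_span_pair_of_pow_eq (hv0 : ∀ i, v i ≠ 0)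
    (hvind : ∀ i j, i ≠ j → LinearIndependent k ![v i, v j]) {m : ℕ}
    (hm : pointsIdeal v ^ (m + 2) = pointsSymb v (m + 2)) :
    ∃ f g : MvPolynomial (Fin 3) k, (∃ d, f.IsHomogeneous d) ∧ (∃ d, g.IsHomogeneous d) ∧
      pointsIdeal v = Ideal.span {f, g} := by
  classical
  set 𝔪 := RingHom.ker (constantCoeff (σ := Fin 3) (R := k))
  have hprime : 𝔪.IsPrime := RingHom.ker_isPrime _
  have hM : 𝔪.primeCompl ≤ nonZeroDivisors _ := 𝔪.primeCompl_le_nonZeroDivisors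
  let B := Localization.AtPrime 𝔪
  let φ := algebraMap (MvPolynomial (Fin 3) k) B
  have : IsDomain B := IsLocalization.isDomain_localization hM
  have : IsNoetherianRing B := IsLocalization.isNoetherianRing 𝔪.primeCompl B inferInstance
  have hmax : IsLocalRing.maximalIdeal B = Ideal.span (Set.range fun l => φ (X l)) := by
    have h1 : 𝔪.map φ = Ideal.span (Set.range fun l => φ (X l)) := by
      refine (congrArg (Ideal.map φ) (ker_constantCoeff_eq_span (Fin 3))).trans ?_
      rw [Ideal.map_span, ← Set.range_comp]
      rfl
    rw [← Localization.AtPrime.map_eq_maximalIdeal]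
    exact h1
  have hgen : ∃ r, ∃ L : Fin r → B,
      (∀ j, ∃ F ∈ pointsIdeal v, (∃ d, F.IsHomogeneous d) ∧ φ F = L j) ∧
      Submodule.span B (Set.range L) = (pointsIdeal v).map φ := by
    have hfg : (Submodule.span (MvPolynomial (Fin 3) k) {f | f ∈ pointsIdeal v ∧ ∃ d,
        f.IsHomogeneous d}).FG :=
      IsNoetherian.noetherian _
    obtain ⟨S, hS, hSI⟩ := Submodule.fg_span_iff_fg_span_finset_subset _ |>.1 hfg
    refine ⟨S.card, fun j => φ (S.equivFin.symm j), fun j => ?_, ?_⟩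
    · obtain ⟨h1, h2⟩ := hS (S.equivFin.symm j).2
      exact ⟨_, h1, h2, rfl⟩
    · rw [← eq_span_isHomogeneous (isHomogeneous_pointsIdeal v), Ideal.span, hSI]
      change _ = Ideal.map φ (Ideal.span _)
      rw [Ideal.map_span]
      congr 1
      ext b
      simp only [Set.mem_range, Set.mem_image, Finset.mem_coe]
      constructor
      · rintro ⟨j, rfl⟩
        exact ⟨_, (S.equivFin.symm j).2, rfl⟩
      · rintro ⟨f, hf, rfl⟩
        exact ⟨S.equivFin ⟨f, hf⟩, by simp⟩
  obtain ⟨n, L, hL, hspan, hmin⟩ := exists_minimal_generators (N := (pointsIdeal v).map φ)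
    (p := fun b => ∃ F ∈ pointsIdeal v, (∃ d, F.IsHomogeneous d) ∧ φ F = b) hgen
  choose F hFI hFhom hFL using hL
  have hspan' : Ideal.span (Set.range L) = (pointsIdeal v).map φ := hspan
  have hn : n ≤ 2 := by
    refine card_le_two_of_pow_saturated (m := m)
      (isRegularTriple_algebraMap_X 𝔪.primeCompl hM) hmax hmin ?_ ?_ ?_ ?_
    · rw [hspan']
      exact fun h => mem_map_of_forall_mul_mem_map 𝔪.primeCompl fun u hu => by
        rw [← pointsSymb_one] at hu ⊢
        exact mem_pointsSymb_of_forall_X_mul_mem hv0 hu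
    · rw [hspan', ← Ideal.map_pow]
      exact fun h => mem_map_of_forall_mul_mem_map 𝔪.primeCompl fun u hu => by
        rw [hm] at hu ⊢
        exact mem_pointsSymb_of_forall_X_mul_mem hv0 hu
    · intro a b hab
      refine dvd_of_forall_mem_map_pointsIdeal 𝔪.primeCompl hM hv0 fun f hf => ?_
      have h1 := Ideal.mem_map_of_mem φ hf
      rw [← hspan] at h1
      obtain ⟨w, hw⟩ := (Submodule.mem_span_range_iff_exists_fun _).1 h1
      rw [show algebraMap _ B f = φ f from rfl, ← hw, Finset.mul_sum]
      refine Finset.dvd_sum fun i _ => ?_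
      rw [smul_eq_mul, mul_left_comm]
      exact (hab i).mul_left _
    · intro P hP hPmax
      obtain ⟨l, hl⟩ : ∃ l, X l ∉ P.comap φ := by
        by_contra! h
        refine hPmax ((IsLocalRing.le_maximalIdeal hP.ne_top).antisymm ?_)
        rw [hmax, Ideal.span_le]
        rintro _ ⟨l, rfl⟩
        exact h l
      obtain ⟨p, hp, q, hq, t, ht, h⟩ :=
        exists_pair_of_isPrime hvind hv0 (hP.comap φ) hl
      refine ⟨φ p, hspan' ▸ Ideal.mem_map_of_mem φ hp, φ q, hspan' ▸ Ideal.mem_map_of_mem φ hq,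
        φ t, ht, fun i => ?_⟩
      have h1 := Ideal.mem_map_of_mem φ (h _ (hFI i))
      rwa [Ideal.map_span, Set.image_pair, map_mul, hFL] at h1
  have hI : pointsIdeal v = Ideal.span (Set.range F) := by
    have hJ : (Ideal.span (Set.range F)).IsHomogeneous (homogeneousSubmodule (Fin 3) k) :=
      Ideal.homogeneous_span _ _ (by rintro _ ⟨i, rfl⟩; exact hFhom i)
    refine le_antisymm ?_ (Ideal.span_le.2 (by rintro _ ⟨i, rfl⟩; exact hFI i))
    rw [← eq_span_isHomogeneous (isHomogeneous_pointsIdeal v), Ideal.span_le]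
    rintro f ⟨hf, d, hd⟩
    have h1 : φ f ∈ (Ideal.span (Set.range F)).map φ := by
      rw [Ideal.map_span, ← Set.range_comp, show φ ∘ F = L from funext hFL, hspan']
      exact Ideal.mem_map_of_mem φ hf
    obtain ⟨t, ht, htf⟩ :=
      (IsLocalization.algebraMap_mem_map_algebraMap_iff 𝔪.primeCompl B _ _).1 h1
    exact mem_of_isHomogeneous_of_mul_mem hJ hd ht htf
  rw [hI]
  clear hI hspan hspan' hmin hFL
  interval_cases n
  · exact ⟨0, 0, ⟨0, isHomogeneous_zero _ _ _⟩, ⟨0, isHomogeneous_zero _ _ _⟩, by simp⟩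
  · exact ⟨F 0, 0, hFhom 0, ⟨0, isHomogeneous_zero _ _ _⟩, by
      rw [Set.range_unique, Ideal.span_pair_zero]; rfl⟩
  · exact ⟨F 0, F 1, hFhom 0, hFhom 1, by congr 1; ext; simp [eq_comm]⟩

end Converse

theorem points_complete_intersection_tfae (k : Type*) [Field k] (s : ℕ) (hs : 1 ≤ s)
    (v : Fin s → (Fin 3 → k)) (hv0 : ∀ i, v i ≠ 0)
    (hvind : ∀ i j, i ≠ j → LinearIndependent k ![v i, v j]) :
    ((∃ f g : MvPolynomial (Fin 3) k, (∃ d, f.IsHomogeneous d) ∧ (∃ d, g.IsHomogeneous d) ∧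
        pointsIdeal v = Ideal.span {f, g}) ↔
      (∀ m : ℕ, 1 ≤ m → pointsIdeal v ^ m = pointsSymb v m)) ∧
    ((∀ m : ℕ, 1 ≤ m → pointsIdeal v ^ m = pointsSymb v m) ↔
      (∃ m : ℕ, 2 ≤ m ∧ pointsIdeal v ^ m = pointsSymb v m)) := by
  have h12 : (∃ f g : MvPolynomial (Fin 3) k, (∃ d, f.IsHomogeneous d) ∧
      (∃ d, g.IsHomogeneous d) ∧ pointsIdeal v = Ideal.span {f, g}) →
      ∀ m : ℕ, 1 ≤ m → pointsIdeal v ^ m = pointsSymb v m :=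
    fun ⟨f, g, _, _, h⟩ m _ => pointsIdeal_pow_eq_of_eq_span_pair hv0 hvind h m
  have h31 : (∃ m : ℕ, 2 ≤ m ∧ pointsIdeal v ^ m = pointsSymb v m) →
      ∃ f g : MvPolynomial (Fin 3) k, (∃ d, f.IsHomogeneous d) ∧ (∃ d, g.IsHomogeneous d) ∧
        pointsIdeal v = Ideal.span {f, g} := by
    rintro ⟨m, hm, h⟩
    obtain ⟨m, rfl⟩ := Nat.exists_eq_add_of_le' hm
    exact exists_eq_span_pair_of_pow_eq hv0 hvind h
  have h23 : (∀ m : ℕ, 1 ≤ m → pointsIdeal v ^ m = pointsSymb v m) →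
      ∃ m : ℕ, 2 ≤ m ∧ pointsIdeal v ^ m = pointsSymb v m :=
    fun h => ⟨2, le_rfl, h 2 one_le_two⟩
  exact ⟨⟨h12, fun h => h31 (h23 h)⟩, ⟨h23, fun h => h12 (h31 h)⟩⟩
end

section
/- Let α := α(I_X) be the least degree of a nonzero homogeneous element of I_X. Then dim_k (I_X)_α = α + 1 if and only if s = C(α+1, 2) and X has the generic Hilbert function, i.e. dim_k R_i − dim_k (I_X)_i = min{C(i+2,2), s} for all i ≥ 0. -/
open MvPolynomial

/-- Evaluation of the forms of degree `t` at a family of points, as a linear map. -/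
noncomputable def evalForms {ι σ K : Type*} [Field K] (w : ι → σ → K) (t : ℕ) :
    homogeneousSubmodule σ K t →ₗ[K] (ι → K) :=
  LinearMap.pi fun i => (aeval (w i)).toLinearMap ∘ₗ (homogeneousSubmodule σ K t).subtype

@[simp]
lemma evalForms_apply {ι σ K : Type*} [Field K] (w : ι → σ → K) (t : ℕ)
    (f : homogeneousSubmodule σ K t) (i : ι) :
    evalForms w t f i = eval (w i) (f : MvPolynomial σ K) := by
  simp [evalForms, aeval_eq_eval]

lemma homogeneousSubmodule_succ_induction {σ K : Type*} [Field K] {t : ℕ}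
    {P : MvPolynomial σ K → Prop}
    (hmul : ∀ u w : MvPolynomial σ K, u.IsHomogeneous 1 → w.IsHomogeneous t → P (u * w))
    (hadd : ∀ f g, P f → P g → P (f + g)) {f : MvPolynomial σ K}
    (hf : f.IsHomogeneous (t + 1)) : P f := by
  have h : f ∈ homogeneousSubmodule σ K 1 * homogeneousSubmodule σ K t := by
    rw [← homogeneousSubmodule_one_pow (σ := σ) (R := K) t, ← pow_succ', homogeneousSubmodule_one_pow]
    exact hf
  exact Submodule.mul_induction_on h (fun u hu w hw => hmul u w hu hw) hadd

/-- Modulo the ideal of a point `p`, a form `f` of degree `t` is proportional to `X_j ^ t`. -/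
lemma C_pow_mul_sub_mem_pointIdeal {K : Type*} [Field K] (p : Fin 3 → K) (j : Fin 3) (t : ℕ)
    {f : MvPolynomial (Fin 3) K} (hf : f.IsHomogeneous t) :
    C (p j) ^ t * f - C (eval p f) * X j ^ t ∈ pointIdeal p := by
  induction t generalizing f with
  | zero =>
    have h : f = C (coeff 0 f) := by
      rw [← totalDegree_eq_zero_iff_eq_C]
      exact (totalDegree_zero_iff_isHomogeneous _).2 hf
    rw [h]
    simp
  | succ t ih =>
    refine homogeneousSubmodule_succ_induction
      (P := fun f => C (p j) ^ (t + 1) * f - C (eval p f) * X j ^ (t + 1) ∈ pointIdeal p)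
      (fun u w hu hw => ?_) (fun f g hf hg => ?_) hf
    · have h1 : C (p j) * u - C (eval p u) * X j ∈ pointIdeal p :=
        Ideal.subset_span ⟨(hu.C_mul _).sub ((isHomogeneous_X K j).C_mul _), by simp [mul_comm]⟩
      have h2 : C (p j) ^ (t + 1) * (u * w) - C (eval p (u * w)) * X j ^ (t + 1) =
          (C (p j) ^ t * w) * (C (p j) * u - C (eval p u) * X j) +
          (C (eval p u) * X j) * (C (p j) ^ t * w - C (eval p w) * X j ^ t) := by
        rw [map_mul, C_mul]
        ring
      rw [h2]
      exact add_mem (Ideal.mul_mem_left _ _ h1) (Ideal.mul_mem_left _ _ (ih hw))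
    · convert add_mem hf hg using 1
      rw [map_add, C_add]
      ring

lemma mem_pointIdeal_iff {K : Type*} [Field K] {p : Fin 3 → K} (hp : p ≠ 0) {t : ℕ}
    {f : MvPolynomial (Fin 3) K} (hf : f.IsHomogeneous t) :
    f ∈ pointIdeal p ↔ eval p f = 0 := by
  constructor
  · intro h
    have hle : pointIdeal p ≤ RingHom.ker (eval p) := Ideal.span_le.2 fun g hg => hg.2
    exact hle h
  · intro h
    obtain ⟨j, hj⟩ := Function.ne_iff.1 hp
    have h1 := C_pow_mul_sub_mem_pointIdeal p j t hf
    rw [h, C_0, zero_mul, sub_zero, ← C_pow] at h1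
    have h2 := Ideal.mul_mem_left _ (C ((p j ^ t)⁻¹)) h1
    rwa [← mul_assoc, ← C_mul, inv_mul_cancel₀ (pow_ne_zero _ hj), C_1, one_mul] at h2

lemma gradedPiece_pointsIdeal {K : Type*} [Field K] {s : ℕ} {v : Fin s → Fin 3 → K}
    (hv0 : ∀ i, v i ≠ 0) (t : ℕ) :
    gradedPiece (pointsIdeal v) t =
      (LinearMap.ker (evalForms v t)).map (homogeneousSubmodule (Fin 3) K t).subtype := by
  ext f
  simp only [gradedPiece, pointsIdeal, Submodule.mem_inf, Submodule.restrictScalars_mem,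
    Submodule.mem_iInf, Submodule.mem_map, LinearMap.mem_ker, funext_iff, evalForms_apply,
    Submodule.subtype_apply, Pi.zero_apply]
  constructor
  · rintro ⟨h1, h2⟩
    exact ⟨⟨f, h2⟩, fun i => (mem_pointIdeal_iff (hv0 i) h2).1 (h1 i), rfl⟩
  · rintro ⟨g, hg, rfl⟩
    exact ⟨fun i => (mem_pointIdeal_iff (hv0 i) g.2).2 (hg i), g.2⟩

lemma finrank_gradedPiece_pointsIdeal {K : Type*} [Field K] {s : ℕ} {v : Fin s → Fin 3 → K}
    (hv0 : ∀ i, v i ≠ 0) (t : ℕ) :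
    Module.finrank K (gradedPiece (pointsIdeal v) t) =
      Module.finrank K (LinearMap.ker (evalForms v t)) := by
  rw [gradedPiece_pointsIdeal hv0]
  exact (Submodule.equivMapOfInjective _ (Submodule.injective_subtype _) _).finrank_eq.symm

instance finite_homogeneousSubmodule {σ K : Type*} [Finite σ] [Field K] (t : ℕ) :
    Module.Finite K (homogeneousSubmodule σ K t) :=
  Module.Finite.iff_fg.2 (homogeneousSubmodule_fg σ K t)

lemma finrank_homogeneousSubmodule (K : Type*) [Field K] (t : ℕ) :
    Module.finrank K (homogeneousSubmodule (Fin 3) K t) = Nat.choose (t + 2) 2 := by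
  have hset : {d : Fin 3 →₀ ℕ | d.degree = t} =
      ((Finset.univ : Finset (Fin 3)).finsuppAntidiag t : Set (Fin 3 →₀ ℕ)) := by
    ext d
    simp [Finset.mem_finsuppAntidiag, Finsupp.degree_eq_sum]
  rw [homogeneousSubmodule_eq_finsupp_supported, hset,
    (AddMonoidAlgebra.supportedEquivFinsupp _).finrank_eq, Module.finrank_finsupp_self]
  simp only [SetLike.coe_sort_coe, Fintype.card_coe, Finset.card_finsuppAntidiag_nat_eq_choose,
    Finset.card_univ, Fintype.card_fin]
  rw [show 3 + t - 1 = t + 2 by omega, ← Nat.choose_symm_add]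

/-- A family of forms of degree one separates the points, after raising the degree with a form
nonvanishing at all the points. -/
lemma evalForms_surjective_of_separating {σ K : Type*} [Field K] {s : ℕ} {w : Fin s → σ → K}
    {l : MvPolynomial σ K} (hl : l.IsHomogeneous 1) (hlw : ∀ i, eval (w i) l ≠ 0)
    (hsep : ∀ i j, i ≠ j → ∃ f : MvPolynomial σ K,
      f.IsHomogeneous 1 ∧ eval (w j) f = 0 ∧ eval (w i) f ≠ 0) (t : ℕ) :
    Function.Surjective (evalForms w (t + s)) := by
  classical
  choose f hf hfj hfi using hsep
  let q : Fin s → Fin s → MvPolynomial σ K := fun i j => if h : i ≠ j then f i j h else l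
  have hq : ∀ i j, (q i j).IsHomogeneous 1 := by
    intro i j
    by_cases h : i ≠ j
    · simpa only [q, dif_pos h] using hf i j h
    · simpa only [q, dif_neg h] using hl
  have hg : ∀ i, (l ^ t * ∏ j, q i j).IsHomogeneous (t + s) := by
    intro i
    have h := (hl.pow t).mul (IsHomogeneous.prod Finset.univ (q i) (fun _ => 1) fun j _ => hq i j)
    simpa using h
  intro c
  refine ⟨∑ i, (c i / eval (w i) (l ^ t * ∏ j, q i j)) • ⟨_, hg i⟩, ?_⟩
  ext m
  rw [map_sum, Finset.sum_apply, Finset.sum_eq_single m]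
  · rw [map_smul, Pi.smul_apply, evalForms_apply, smul_eq_mul]
    refine div_mul_cancel₀ _ ?_
    rw [map_mul, map_pow, map_prod]
    refine mul_ne_zero (pow_ne_zero _ (hlw m)) (Finset.prod_ne_zero_iff.2 fun j _ => ?_)
    by_cases h : m ≠ j
    · simpa only [q, dif_pos h] using hfi m j h
    · simpa only [q, dif_neg h] using hlw m
  · intro i _ him
    rw [map_smul, Pi.smul_apply, evalForms_apply, smul_eq_mul]
    refine mul_eq_zero_of_right _ ?_
    rw [map_mul, map_prod, Finset.prod_eq_zero (Finset.mem_univ m), mul_zero]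
    simpa only [q, dif_pos him] using hfj i m him
  · simp

lemma exists_form_eq_mul_of_finrank_ker {K : Type*} [Field K] {s : ℕ} {w : Fin s → Fin 3 → K}
    {l : MvPolynomial (Fin 3) K} (hl : l.IsHomogeneous 1) (hlw : ∀ i, eval (w i) l ≠ 0) {a : ℕ}
    (hker : LinearMap.ker (evalForms w a) = ⊥)
    (hdim : a + 2 ≤ Module.finrank K (LinearMap.ker (evalForms w (a + 1))))
    {f : MvPolynomial (Fin 3) K} (hf : f.IsHomogeneous (a + 1)) :
    ∃ g : MvPolynomial (Fin 3) K, g.IsHomogeneous a ∧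
      ∀ i, eval (w i) f = eval (w i) l * eval (w i) g := by
  let μ : homogeneousSubmodule (Fin 3) K a →ₗ[K] homogeneousSubmodule (Fin 3) K (a + 1) :=
    ((LinearMap.mulLeft K l).comp (Submodule.subtype _)).codRestrict _ fun g => by
      have := hl.mul g.2
      rwa [add_comm] at this
  have hμ : ∀ g, ((μ g : homogeneousSubmodule (Fin 3) K (a + 1)) : MvPolynomial (Fin 3) K) =
      l * g := fun g => rfl
  have hinj : ∀ g, evalForms w (a + 1) (μ g) = 0 → g = 0 := by
    intro g hg
    rw [← Submodule.mem_bot K, ← hker, LinearMap.mem_ker]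
    ext i
    have := congrFun hg i
    rw [evalForms_apply, hμ, map_mul] at this
    simpa [hlw i] using this
  have hμinj : Function.Injective μ := by
    rw [← LinearMap.ker_eq_bot, LinearMap.ker_eq_bot']
    exact fun g hg => hinj g (by rw [hg, map_zero])
  have hdisj : LinearMap.ker (evalForms w (a + 1)) ⊓ LinearMap.range μ = ⊥ := by
    rw [eq_bot_iff]
    rintro _ ⟨h1, g, rfl⟩
    rw [hinj g h1, map_zero]
    exact zero_mem _
  have hsum := Submodule.finrank_sup_add_finrank_inf_eq
    (LinearMap.ker (evalForms w (a + 1))) (LinearMap.range μ)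
  rw [hdisj, finrank_bot, LinearMap.finrank_range_of_inj hμinj, finrank_homogeneousSubmodule]
    at hsum
  have htop : LinearMap.ker (evalForms w (a + 1)) ⊔ LinearMap.range μ = ⊤ := by
    refine Submodule.eq_top_of_finrank_eq (le_antisymm (Submodule.finrank_le _) ?_)
    rw [finrank_homogeneousSubmodule]
    have : (a + 1 + 2).choose 2 = (a + 2) + (a + 2).choose 2 := by
      rw [Nat.choose_succ_succ' (a + 2) 1, Nat.choose_one_right]
    omega
  have hmem : (⟨f, hf⟩ : homogeneousSubmodule (Fin 3) K (a + 1)) ∈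
      LinearMap.ker (evalForms w (a + 1)) ⊔ LinearMap.range μ := htop ▸ Submodule.mem_top
  obtain ⟨h, hh, _, ⟨g, rfl⟩, hfg⟩ := Submodule.mem_sup.1 hmem
  refine ⟨g, g.2, fun i => ?_⟩
  have h1 := congrArg Subtype.val hfg
  have h2 := congrFun (LinearMap.mem_ker.1 hh) i
  simp only [Submodule.coe_add, hμ] at h1
  rw [evalForms_apply] at h2
  rw [← h1, map_add, h2, map_mul]
  simp

lemma exists_form_eq_pow_mul_of_finrank_ker {K : Type*} [Field K] {s : ℕ}
    {w : Fin s → Fin 3 → K} {l : MvPolynomial (Fin 3) K} (hl : l.IsHomogeneous 1)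
    (hlw : ∀ i, eval (w i) l ≠ 0) {a : ℕ} (hker : LinearMap.ker (evalForms w a) = ⊥)
    (hdim : a + 2 ≤ Module.finrank K (LinearMap.ker (evalForms w (a + 1)))) (n : ℕ)
    {f : MvPolynomial (Fin 3) K} (hf : f.IsHomogeneous (a + n)) :
    ∃ g : MvPolynomial (Fin 3) K, g.IsHomogeneous a ∧
      ∀ i, eval (w i) f = eval (w i) l ^ n * eval (w i) g := by
  induction n generalizing f with
  | zero => exact ⟨f, hf, by simp⟩
  | succ n ih =>
    rw [← add_assoc] at hf
    refine homogeneousSubmodule_succ_induction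
      (P := fun f => ∃ g : MvPolynomial (Fin 3) K, g.IsHomogeneous a ∧
        ∀ i, eval (w i) f = eval (w i) l ^ (n + 1) * eval (w i) g)
      (fun u x hu hx => ?_) (fun f₁ f₂ h₁ h₂ => ?_) hf
    · obtain ⟨g, hg, hxg⟩ := ih hx
      obtain ⟨g', hg', hgg'⟩ := exists_form_eq_mul_of_finrank_ker hl hlw hker hdim
        (f := u * g) (by simpa [add_comm] using hu.mul hg)
      refine ⟨g', hg', fun i => ?_⟩
      have := hgg' i
      rw [map_mul] at this
      rw [map_mul, hxg i, pow_succ, mul_assoc, ← this]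
      ring
    · obtain ⟨g₁, hg₁, e₁⟩ := h₁
      obtain ⟨g₂, hg₂, e₂⟩ := h₂
      exact ⟨g₁ + g₂, hg₁.add hg₂, fun i => by rw [map_add, map_add, e₁, e₂, mul_add]⟩

/-- If no form of degree `a` vanishes at the points and at least `a + 2` independent forms of
degree `a + 1` do, then there are at most `(a + 2).choose 2` points, provided that some linear form
is nonzero at all of them. -/
lemma card_points_le_of_finrank_ker {K : Type*} [Field K] {s : ℕ} {w : Fin s → Fin 3 → K}
    {l : MvPolynomial (Fin 3) K} (hl : l.IsHomogeneous 1) (hlw : ∀ i, eval (w i) l ≠ 0)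
    (hsep : ∀ i j, i ≠ j → ∃ f : MvPolynomial (Fin 3) K,
      f.IsHomogeneous 1 ∧ eval (w j) f = 0 ∧ eval (w i) f ≠ 0) {a : ℕ}
    (hker : LinearMap.ker (evalForms w a) = ⊥)
    (hdim : a + 2 ≤ Module.finrank K (LinearMap.ker (evalForms w (a + 1)))) :
    s ≤ Nat.choose (a + 2) 2 := by
  have hsurj : Function.Surjective (evalForms w a) := by
    intro c
    obtain ⟨⟨f, hf⟩, hfc⟩ := evalForms_surjective_of_separating hl hlw hsep a
      fun i => eval (w i) l ^ s * c i
    obtain ⟨g, hg, hfg⟩ := exists_form_eq_pow_mul_of_finrank_ker hl hlw hker hdim s hf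
    refine ⟨⟨g, hg⟩, ?_⟩
    ext i
    have := congrFun hfc i
    rw [evalForms_apply] at this ⊢
    exact mul_left_cancel₀ (pow_ne_zero s (hlw i)) ((hfg i).symm.trans this)
  have := LinearMap.finrank_le_finrank_of_surjective hsurj
  rwa [Module.finrank_fin_fun, finrank_homogeneousSubmodule] at this

lemma exists_linearForm_separating {σ K : Type*} [Fintype σ] [Field K] {x y : σ → K}
    (h : LinearIndependent K ![x, y]) :
    ∃ f : MvPolynomial σ K, f.IsHomogeneous 1 ∧ eval y f = 0 ∧ eval x f ≠ 0 := by
  classical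
  have hx : x ∉ Submodule.span K {y} := by
    intro hmem
    obtain ⟨c, hc⟩ := Submodule.mem_span_singleton.1 hmem
    have := LinearIndependent.pair_iff.1 h 1 (-c) (by rw [← hc]; simp)
    exact one_ne_zero this.1
  obtain ⟨φ, hφx, hφ⟩ := Submodule.exists_le_ker_of_notMem hx
  have he : ∀ z, eval z (∑ i, C (φ (Pi.single i 1)) * X i : MvPolynomial σ K) = φ z := by
    intro z
    rw [LinearMap.pi_apply_eq_sum_univ φ z, map_sum]
    refine Finset.sum_congr rfl fun i _ => ?_
    rw [map_mul, eval_C, eval_X, smul_eq_mul, mul_comm]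
    congr 2
    ext j
    simp [Pi.single_apply, eq_comm]
  refine ⟨∑ i, C (φ (Pi.single i 1)) * X i, IsHomogeneous.sum _ _ 1 fun i _ => (isHomogeneous_X K i).C_mul _, ?_, ?_⟩
  · rw [he]
    exact hφ (Submodule.mem_span_singleton_self y)
  · rwa [he]

/-- Over the field of rational functions some linear form is nonzero at all of the given points
of the ground field. -/
lemma exists_linearForm_ratFunc {K : Type*} [Field K] {s : ℕ} {v : Fin s → Fin 3 → K}
    (hv0 : ∀ i, v i ≠ 0) :
    ∃ l : MvPolynomial (Fin 3) (RatFunc K), l.IsHomogeneous 1 ∧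
      ∀ i, eval (fun j => algebraMap K (RatFunc K) (v i j)) l ≠ 0 := by
  refine ⟨∑ j : Fin 3, C (RatFunc.X ^ (j : ℕ)) * X j,
    IsHomogeneous.sum _ _ 1 fun j _ => (isHomogeneous_X _ j).C_mul _, fun i h => hv0 i ?_⟩
  have h1 : algebraMap (Polynomial K) (RatFunc K)
      (∑ j : Fin 3, Polynomial.X ^ (j : ℕ) * Polynomial.C (v i j)) = 0 := by
    rw [← h, map_sum, map_sum]
    refine Finset.sum_congr rfl fun j _ => ?_
    simp [RatFunc.algebraMap_X, RatFunc.algebraMap_C, mul_comm (RatFunc.C _)]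
  rw [map_eq_zero_iff _ (RatFunc.algebraMap_injective K)] at h1
  ext m
  have h2 := congrArg (fun q => Polynomial.coeff q (m : ℕ)) h1
  simpa [Polynomial.finsetSum_coeff, Polynomial.coeff_X_pow, Fin.val_inj] using h2

lemma ker_evalForms_baseChange_eq_bot {ι σ K L : Type*} [Field K] [Field L] [Algebra K L]
    {v : ι → σ → K} {t : ℕ} (h : LinearMap.ker (evalForms v t) = ⊥) :
    LinearMap.ker (evalForms (fun i j => algebraMap K L (v i j)) t) = ⊥ := by
  rw [LinearMap.ker_eq_bot'] at h ⊢
  rintro ⟨f, hf⟩ hfv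
  have key : ∀ φ : Module.Dual K L, ∀ d, φ (coeff d f) = 0 := by
    intro φ d
    let g : MvPolynomial σ K := ∑ m ∈ f.support, monomial m (φ (coeff m f))
    have hg : g.IsHomogeneous t := IsHomogeneous.sum _ _ _ fun m hm =>
      isHomogeneous_monomial _ (by
        rw [Finsupp.degree_eq_weight_one]
        exact hf (mem_support_iff.1 hm))
    have hg0 : (⟨g, hg⟩ : homogeneousSubmodule σ K t) = 0 := by
      refine h _ (funext fun i => ?_)
      have hi := congrArg φ (congrFun hfv i)
      rw [evalForms_apply, eval_eq, map_sum] at hi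
      rw [evalForms_apply, map_sum]
      refine Eq.trans (Finset.sum_congr rfl fun m _ => ?_) (hi.trans (by simp))
      rw [eval_monomial]
      simp only [← map_pow, ← map_prod]
      rw [mul_comm (coeff m f), ← Algebra.smul_def, map_smul, smul_eq_mul, mul_comm]
      rfl
    have hd := congrArg (coeff d) (congrArg Subtype.val hg0)
    by_cases hdf : d ∈ f.support
    · classical
      simpa [g, coeff_sum, coeff_monomial, Finset.sum_ite_eq', mem_support_iff.1 hdf] using hd
    · rw [notMem_support_iff.1 hdf, map_zero]
  ext d
  exact (Module.forall_dual_apply_eq_zero_iff K _).1 fun φ => key φ d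

lemma linearIndependent_map_algebraMap {ι σ K : Type*} (L : Type*) [Fintype ι] [Field K] [Field L]
    [Algebra K L] {P : ι → MvPolynomial σ K} (hP : LinearIndependent K P) :
    LinearIndependent L fun n => map (algebraMap K L) (P n) := by
  rw [Fintype.linearIndependent_iff] at hP ⊢
  intro c hc n
  refine (Module.forall_dual_apply_eq_zero_iff K _).1 fun φ => hP (fun m => φ (c m)) ?_ n
  ext d
  have hd := congrArg (fun q => φ (coeff d q)) hc
  simp only [coeff_sum, coeff_smul, coeff_map, map_sum, smul_eq_mul] at hd ⊢
  refine Eq.trans (Finset.sum_congr rfl fun m _ => ?_) (hd.trans (by simp))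
  rw [mul_comm (c m), ← Algebra.smul_def, map_smul, smul_eq_mul, mul_comm]

lemma eval_map_algebraMap_comp {σ K L : Type*} [Field K] [Field L] [Algebra K L] (p : σ → K)
    (f : MvPolynomial σ K) :
    eval (fun j => algebraMap K L (p j)) (map (algebraMap K L) f) = algebraMap K L (eval p f) := by
  rw [eval_map, ← eval₂_id, eval₂_comp_left]
  rfl

lemma finrank_ker_evalForms_le_baseChange {ι σ K L : Type*} [Finite σ] [Field K] [Field L]
    [Algebra K L] (v : ι → σ → K) (t : ℕ) :
    Module.finrank K (LinearMap.ker (evalForms v t)) ≤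
      Module.finrank L (LinearMap.ker (evalForms (fun i j => algebraMap K L (v i j)) t)) := by
  let W := (LinearMap.ker (evalForms v t)).map (homogeneousSubmodule σ K t).subtype
  have hW : Module.finrank K (LinearMap.ker (evalForms v t)) = Module.finrank K W :=
    (Submodule.equivMapOfInjective _ (Submodule.injective_subtype _) _).finrank_eq
  let b := Module.finBasis K W
  have hb : LinearIndependent K fun n => (b n : MvPolynomial σ K) :=
    b.linearIndependent.map' W.subtype W.ker_subtype
  choose g hg hgb using fun n => Submodule.mem_map.1 (b n).2
  have hker : ∀ n, (⟨map (algebraMap K L) (g n), IsHomogeneous.map (g n).2 _⟩ :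
      homogeneousSubmodule σ L t) ∈
      LinearMap.ker (evalForms (fun i j => algebraMap K L (v i j)) t) := by
    intro n
    rw [LinearMap.mem_ker]
    ext i
    have h := congrFun (LinearMap.mem_ker.1 (hg n)) i
    rw [evalForms_apply] at h
    rw [evalForms_apply]
    exact (eval_map_algebraMap_comp (v i) (g n).1).trans (by rw [h]; simp)
  have hli : LinearIndependent L fun n =>
      (⟨_, hker n⟩ : LinearMap.ker (evalForms (fun i j => algebraMap K L (v i j)) t)) := by
    refine LinearIndependent.of_comp ((Submodule.subtype _).comp (Submodule.subtype _)) ?_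
    have h := linearIndependent_map_algebraMap L hb
    simp only [← hgb] at h
    exact h
  rw [hW]
  simpa using hli.fintype_card_le_finrank

lemma evalForms_surjective_succ {σ K : Type*} [Field K] {s : ℕ} {v : Fin s → σ → K}
    (hv0 : ∀ i, v i ≠ 0) {t : ℕ} (h : Function.Surjective (evalForms v t)) :
    Function.Surjective (evalForms v (t + 1)) := by
  classical
  choose j hj using fun i => Function.ne_iff.1 (hv0 i)
  choose g hg using fun i => h (Pi.single i 1)
  have hh : ∀ i, (X (j i) * (g i).1).IsHomogeneous (t + 1) := fun i => by
    rw [add_comm]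
    exact (isHomogeneous_X K (j i)).mul (g i).2
  intro c
  refine ⟨∑ i, (c i / v i (j i)) • ⟨_, hh i⟩, ?_⟩
  ext m
  have he : ∀ i, eval (v m) (g i).1 = (Pi.single i 1 : Fin s → K) m := fun i => by
    rw [← hg i, evalForms_apply]
  rw [map_sum, Finset.sum_apply, Finset.sum_eq_single m]
  · simpa [he] using div_mul_cancel₀ (c m) (hj m)
  · intro i _ him
    simp [he, him]
  · simp

theorem points_max_gens_iff_generic (k : Type*) [Field k] (s : ℕ) (hs : 1 ≤ s)
    (v : Fin s → (Fin 3 → k)) (hv0 : ∀ i, v i ≠ 0)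
    (hvind : ∀ i j, i ≠ j → LinearIndependent k ![v i, v j])
    (α : ℕ) (hα : α = sInf {t : ℕ | gradedPiece (pointsIdeal v) t ≠ ⊥}) :
    Module.finrank k (gradedPiece (pointsIdeal v) α) = α + 1 ↔
      (s = Nat.choose (α + 1) 2 ∧
        ∀ i : ℕ, Nat.choose (i + 2) 2 - Module.finrank k (gradedPiece (pointsIdeal v) i) =
          min (Nat.choose (i + 2) 2) s) := by
  have hfr := finrank_gradedPiece_pointsIdeal hv0
  have hrn : ∀ t, Module.finrank k (LinearMap.range (evalForms v t)) +
      Module.finrank k (LinearMap.ker (evalForms v t)) = Nat.choose (t + 2) 2 := fun t => by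
    rw [LinearMap.finrank_range_add_finrank_ker, finrank_homogeneousSubmodule]
  have hrs : ∀ t, Module.finrank k (LinearMap.range (evalForms v t)) ≤ s := fun t => by
    simpa using Submodule.finrank_le (LinearMap.range (evalForms v t))
  have hbelow : ∀ t < α, Module.finrank k (LinearMap.ker (evalForms v t)) = 0 := by
    intro t ht
    rw [hα] at ht
    have := Nat.notMem_of_lt_sInf ht
    rw [Set.mem_ofPred_eq, not_not] at this
    rw [← hfr, this, finrank_bot]
  have hchoose : ∀ a : ℕ, (a + 2).choose 2 = (a + 1) + (a + 1).choose 2 := fun a => by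
    rw [Nat.choose_succ_succ' (a + 1) 1, Nat.choose_one_right]
  constructor
  · intro h
    rw [hfr] at h
    obtain _ | a := α
    · have hker : LinearMap.ker (evalForms v 0) = ⊥ := by
        rw [LinearMap.ker_eq_bot']
        rintro ⟨f, hf⟩ hf0
        have hC : f = C (coeff 0 f) := by
          rw [← totalDegree_eq_zero_iff_eq_C]
          exact (totalDegree_zero_iff_isHomogeneous _).2 hf
        have := congrFun hf0 ⟨0, hs⟩
        rw [evalForms_apply, Subtype.coe_mk, hC, eval_C] at this
        ext1
        change f = 0
        rw [hC, this]
        simp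
      rw [hker, finrank_bot] at h
      omega
    · have hker := hbelow a (Nat.lt_succ_self a)
      have hker' : LinearMap.ker (evalForms v a) = ⊥ := Submodule.finrank_eq_zero.1 hker
      have hle : s ≤ Nat.choose (a + 2) 2 := by
        obtain ⟨l, hl, hlv⟩ := exists_linearForm_ratFunc hv0
        refine card_points_le_of_finrank_ker hl hlv ?_
          (ker_evalForms_baseChange_eq_bot (L := RatFunc k) hker')
          (h.symm.le.trans (finrank_ker_evalForms_le_baseChange v (a + 1)))
        intro i j hij
        obtain ⟨f, hf, hfj, hfi⟩ := exists_linearForm_separating (hvind i j hij)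
        refine ⟨map (algebraMap k (RatFunc k)) f, hf.map _, ?_, ?_⟩
        · rw [eval_map_algebraMap_comp, hfj, map_zero]
        · rw [eval_map_algebraMap_comp]
          simpa using hfi
      have hra := hrn a
      have hsa := hrs a
      have hseq : s = Nat.choose (a + 2) 2 := by omega
      have hsurj : ∀ n, Function.Surjective (evalForms v (a + n)) := by
        intro n
        induction n with
        | zero =>
          rw [← LinearMap.range_eq_top]
          refine Submodule.eq_top_of_finrank_eq ?_
          rw [Module.finrank_fin_fun, Nat.add_zero]
          omega
        | succ n ih => exact evalForms_surjective_succ hv0 ih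
      refine ⟨hseq, fun i => ?_⟩
      have hri := hrn i
      have hsi := hrs i
      rw [hfr]
      obtain hi | hi := Nat.lt_or_ge i (a + 1)
      · have := hbelow i hi
        omega
      · obtain ⟨n, rfl⟩ := Nat.exists_eq_add_of_le (Nat.le_of_succ_le hi)
        rw [LinearMap.range_eq_top.2 (hsurj n), finrank_top, Module.finrank_fin_fun] at hri
        omega
  · rintro ⟨hseq, hgen⟩
    have h1 := hgen α
    have h2 := hchoose α
    omega
end
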